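/- Let w ∈ TS be a nontrivial cyclically reduced word. If α ∈ Aut(F_k) is such that α(w) is conjugate to w in F_k, then α is an inner automorphism of F_k. -/

import Mathlib

/-! Common definitions: free group `FG k = F(a_1,…,a_k)`, reduced and cyclically
reduced words, Whitehead automorphisms, strict minimality, counting functions and
exponential genericity, following Kapovich–Schupp–Shpilrain. -/

/-- The free group of rank `k` on the basis `a_1,…,a_k`. -/
abbrev FG (k : ℕ) := FreeGroup (Fin k)

/-- The alphabet `Σ = {a_1,…,a_k}^{±1}`: a letter is a basis index together with a sign. -/
abbrev Letter (k : ℕ) := Fin k × Bool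

/-- The inverse of a letter. -/
def linv {k : ℕ} (x : Letter k) : Letter k := (x.1, !x.2)

/-- The length `|g|` of the reduced word representing `g`. -/
def wordLength {k : ℕ} (g : FG k) : ℕ := (FreeGroup.toWord g).length

/-- A word is (freely) reduced if it equals its free reduction. -/
def ReducedWord {k : ℕ} (w : List (Letter k)) : Prop := FreeGroup.reduce w = w

/-- A word is cyclically reduced if all of its cyclic permutations are reduced;
equivalently, `w ++ w` is reduced. -/
def CyclicallyReducedWord {k : ℕ} (w : List (Letter k)) : Prop :=
  FreeGroup.reduce (w ++ w) = w ++ w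

/-- An element of `FG k` is cyclically reduced if its reduced word is. -/
def IsCyclicallyReduced {k : ℕ} (g : FG k) : Prop :=
  CyclicallyReducedWord (FreeGroup.toWord g)

/-- `C`, the set of all cyclically reduced elements of `FG k`. -/
def Cset (k : ℕ) : Set (FG k) := {g | IsCyclicallyReduced g}

/-- The cyclic length `‖g‖`: the length of the cyclically reduced form of `g`
(the unique cyclically reduced `u` with `g = x u x⁻¹`). -/
noncomputable def cyclicLength {k : ℕ} (g : FG k) : ℕ :=
  sInf {n | ∃ x u : FG k, IsCyclicallyReduced u ∧ g = x * u * x⁻¹ ∧ wordLength u = n}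

/-- The set `Σ = {a_1,…,a_k}^{±1}` inside the free group. -/
def letterSet (k : ℕ) : Set (FG k) :=
  {g | ∃ i : Fin k, g = FreeGroup.of i ∨ g = (FreeGroup.of i)⁻¹}

/-- A Whitehead automorphism of the first kind: a relabeling automorphism,
i.e. one whose restriction to `Σ` is a permutation of `Σ`. -/
def IsRelabeling {k : ℕ} (τ : MulAut (FG k)) : Prop :=
  (⇑τ) '' letterSet k = letterSet k

/-- A Whitehead automorphism of the second kind, with multiplier `a ∈ Σ`:
`τ a = a` and `τ x ∈ {x, xa, a⁻¹x, a⁻¹xa}` for all `x ∈ Σ`. -/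
def IsWhitehead2 {k : ℕ} (τ : MulAut (FG k)) : Prop :=
  ∃ a ∈ letterSet k, τ a = a ∧
    ∀ x ∈ letterSet k, τ x = x ∨ τ x = x * a ∨ τ x = a⁻¹ * x ∨ τ x = a⁻¹ * x * a

/-- An automorphism is inner if it is conjugation by some element. -/
def IsInner {k : ℕ} (α : MulAut (FG k)) : Prop := ∃ g : FG k, α = MulAut.conj g

/-- `SM`: the set of strictly minimal cyclically reduced elements, those `w` with
`‖τ w‖ > |w|` for every non-inner Whitehead automorphism `τ` of the second kind. -/
def SM (k : ℕ) : Set (FG k) :=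
  {w | IsCyclicallyReduced w ∧
    ∀ τ : MulAut (FG k), IsWhitehead2 τ → ¬ IsInner τ → wordLength w < cyclicLength (τ w)}

/-- `SM'`: elements whose cyclically reduced form lies in `SM`. -/
def SM' (k : ℕ) : Set (FG k) := {g | ∃ x u : FG k, u ∈ SM k ∧ g = x * u * x⁻¹}

/-- `γ(n,S)`: the number of elements of `S` of length `n`. -/
noncomputable def gammaC {k : ℕ} (S : Set (FG k)) (n : ℕ) : ℕ :=
  {g ∈ S | wordLength g = n}.ncard

/-- `ρ(n,S)`: the number of elements of `S` of length at most `n`. -/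
noncomputable def rhoC {k : ℕ} (S : Set (FG k)) (n : ℕ) : ℕ :=
  {g ∈ S | wordLength g ≤ n}.ncard

/-- `B ⊆ S` is exponentially generic in `S` if `ρ(n,B)/ρ(n,S) → 1`
exponentially fast. -/
def ExpGenericIn {k : ℕ} (B S : Set (FG k)) : Prop :=
  B ⊆ S ∧ ∃ K : ℝ, 0 < K ∧ ∃ σ : ℝ, 0 < σ ∧ σ < 1 ∧
    ∀ n : ℕ, |1 - (rhoC B n : ℝ) / (rhoC S n : ℝ)| ≤ K * σ ^ n

/-- `B` is exponentially negligible in `S` if `S \ B` is exponentially generic in `S`. -/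
def ExpNegligibleIn {k : ℕ} (B S : Set (FG k)) : Prop := ExpGenericIn (S \ B) S

/-- The orbit `Aut(F_k) w`. -/
def autOrbit {k : ℕ} (w : FG k) : Set (FG k) := {g | ∃ α : MulAut (FG k), α w = g}

/-- `u` is a cyclic permutation of `v`: the reduced word of `u` is a rotation of
the reduced word of `v`. -/
def IsCyclicPerm {k : ℕ} (u v : FG k) : Prop :=
  ∃ n : ℕ, FreeGroup.toWord u = (FreeGroup.toWord v).rotate n

/-- `w` is a proper power: `w = uⁿ` for some `n ≥ 2`. -/
def IsProperPower {k : ℕ} (w : FG k) : Prop := ∃ (u : FG k) (n : ℕ), 2 ≤ n ∧ w = u ^ n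

/-- `TS`: strictly minimal cyclically reduced `w` which are not proper powers and
are not conjugate to `τ w` for any nontrivial relabeling automorphism `τ`. -/
def TS (k : ℕ) : Set (FG k) :=
  {w | w ∈ SM k ∧ ¬ IsProperPower w ∧
    ∀ τ : MulAut (FG k), IsRelabeling τ → τ ≠ 1 → ¬ IsConj (τ w) w}

/-- `TS'`: elements whose cyclically reduced form lies in `TS`. -/
def TS' (k : ℕ) : Set (FG k) := {g | ∃ x u : FG k, u ∈ TS k ∧ g = x * u * x⁻¹}

/-- `Z`: elements of `TS` such that no relabeling automorphism sends `w` to a cyclic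
permutation of `w⁻¹`. -/
def Zset (k : ℕ) : Set (FG k) :=
  {w | w ∈ TS k ∧ ¬ ∃ τ : MulAut (FG k), IsRelabeling τ ∧ IsCyclicPerm (τ w) w⁻¹}

/-- Growth entropy `H(S) = limsup ρ(n,S)^{1/n}`. -/
noncomputable def entropyH {k : ℕ} (S : Set (FG k)) : ℝ :=
  Filter.limsup (fun n : ℕ => (rhoC S n : ℝ) ^ ((n : ℝ)⁻¹)) Filter.atTop

/-- Number of occurrences of the two-letter word `xy` as a subword of `w`. -/
def countPair {k : ℕ} (w : List (Letter k)) (x y : Letter k) : ℕ :=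
  (w.zip w.tail).count (x, y)

/-- The label `ŵ_{xy}` of the edge `[x⁻¹, y]` in the weighted Whitehead graph of the
cyclically reduced word `w`: occurrences of `xy` and of `y⁻¹x⁻¹` in `wc`, where `c` is
the first letter of `w`. -/
def whLabel {k : ℕ} (w : List (Letter k)) (x y : Letter k) : ℕ :=
  countPair (w ++ w.take 1) x y + countPair (w ++ w.take 1) (linv y) (linv x)

/-- The one-relator group `G_u = ⟨a_1,…,a_k ∣ u = 1⟩`. -/
abbrev OneRel (k : ℕ) (u : FG k) := FG k ⧸ Subgroup.normalClosure ({u} : Set (FG k))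

/-- `u` is primitive: it belongs to some free basis of `FG k`, equivalently it is the
image of a basis element under an automorphism. -/
def IsPrimitive {k : ℕ} (u : FG k) : Prop :=
  ∃ (α : MulAut (FG k)) (i : Fin k), α (FreeGroup.of i) = u


section basics
variable {k : ℕ}

/-- the group element of a letter -/
def lt (x : Letter k) : FG k := FreeGroup.mk [x]

lemma linv_linv (x : Letter k) : linv (linv x) = x := by simp [linv]

lemma linv_ne (x : Letter k) : linv x ≠ x := by
  intro h
  have := congrArg Prod.snd h
  simp [linv] at this

lemma lt_linv (x : Letter k) : lt (linv x) = (lt x)⁻¹ := by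
  simp [lt, linv, FreeGroup.invRev]

lemma toWord_lt (x : Letter k) : (lt x).toWord = [x] := by
  simp [lt]

lemma mk_toWord_of_red {L : List (Letter k)} (h : FreeGroup.IsReduced L) :
    (FreeGroup.mk L).toWord = L := by
  rw [FreeGroup.toWord_mk, h.reduce_eq]

lemma ne_linv_iff {x y : Letter k} : y ≠ linv x ↔ (x.1 = y.1 → x.2 = y.2) := by
  obtain ⟨a, b⟩ := x
  obtain ⟨c, d⟩ := y
  simp only [linv, ne_eq, Prod.mk.injEq, not_and]
  cases b <;> cases d <;> simp [eq_comm]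

lemma red_append {L1 L2 : List (Letter k)} (h1 : FreeGroup.IsReduced L1)
    (h2 : FreeGroup.IsReduced L2)
    (h : ∀ x ∈ L1.getLast?, ∀ y ∈ L2.head?, y ≠ linv x) :
    FreeGroup.IsReduced (L1 ++ L2) := by
  unfold FreeGroup.IsReduced at *
  rw [List.isChain_append]
  exact ⟨h1, h2, fun x hx y hy => ne_linv_iff.1 (h x hx y hy)⟩

lemma red_append_iff {L1 L2 : List (Letter k)} :
    FreeGroup.IsReduced (L1 ++ L2) ↔ FreeGroup.IsReduced L1 ∧ FreeGroup.IsReduced L2 ∧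
    (∀ x ∈ L1.getLast?, ∀ y ∈ L2.head?, y ≠ linv x) := by
  unfold FreeGroup.IsReduced at *
  rw [List.isChain_append]
  simp only [ne_linv_iff]

lemma list_decomp (L1 : List (Letter k)) : ∀ L2 : List (Letter k), FreeGroup.IsReduced L1 →
    FreeGroup.IsReduced L2 → ∃ p c s, L1 = p ++ c ∧ L2 = FreeGroup.invRev c ++ s ∧
      FreeGroup.IsReduced (p ++ s) := by
  induction L1 using List.reverseRecOn with
  | nil => intro L2 _ h2; exact ⟨[], [], L2, rfl, by simp, h2⟩
  | append_singleton l x ih =>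
    intro L2 h1 h2
    by_cases hh : ∀ y ∈ L2.head?, y ≠ linv x
    · exact ⟨l ++ [x], [], L2, by simp, by simp, red_append h1 h2 (by simpa using hh)⟩
    · push Not at hh
      obtain ⟨y, hy, rfl⟩ := hh
      obtain ⟨t, rfl⟩ : ∃ t, L2 = linv x :: t := by
        cases L2 with
        | nil => simp at hy
        | cons a t => simp at hy; exact ⟨t, by rw [hy]⟩
      have h1' := (red_append_iff.1 h1).1
      have h2' : FreeGroup.IsReduced t := by
        have : linv x :: t = [linv x] ++ t := rfl
        rw [this, red_append_iff] at h2
        exact h2.2.1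
      obtain ⟨p, c, s, rfl, rfl, h3⟩ := ih t h1' h2'
      exact ⟨p, c ++ [x], s, by simp, by simp [FreeGroup.invRev, linv], h3⟩

lemma mul_decomp (g h : FG k) : ∃ p c s, g.toWord = p ++ c ∧ h.toWord = FreeGroup.invRev c ++ s ∧
    (g * h).toWord = p ++ s := by
  obtain ⟨p, c, s, h1, h2, h3⟩ := list_decomp g.toWord h.toWord FreeGroup.isReduced_toWord
    FreeGroup.isReduced_toWord
  refine ⟨p, c, s, h1, h2, ?_⟩
  have : g * h = FreeGroup.mk (p ++ s) := by
    rw [← FreeGroup.mk_toWord (x := g), ← FreeGroup.mk_toWord (x := h), h1, h2,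
      ← FreeGroup.mul_mk, ← FreeGroup.mul_mk, ← FreeGroup.mul_mk, ← FreeGroup.inv_mk]
    group
  rw [this, mk_toWord_of_red h3]

lemma hd_mul (g h : FG k) (hl : h.toWord.length < g.toWord.length) :
    (g * h).toWord.head? = g.toWord.head? := by
  obtain ⟨p, c, s, h1, h2, h3⟩ := mul_decomp g h
  have : p ≠ [] := by
    rintro rfl
    rw [h1, h2] at hl
    simp at hl
  rw [h3, h1]
  cases p with
  | nil => exact absurd rfl this
  | cons a t => simp

/-- elements whose first letter lies in `Y` -/
def Sset (Y : Set (Letter k)) : Set (FG k) := {g | ∃ x ∈ Y, g.toWord.head? = some x}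

/-- elements whose reduced word extends that of `g` -/
def cone (g : FG k) : Set (FG k) := {h | g.toWord <+: h.toWord}

lemma mem_Sset_of {Y : Set (Letter k)} {g : FG k} {y : Letter k}
    (h : g.toWord.head? = some y) : g ∈ Sset Y ↔ y ∈ Y := by
  constructor
  · rintro ⟨z, hz, hz2⟩
    rw [h] at hz2
    cases hz2
    exact hz
  · intro hy; exact ⟨y, hy, h⟩

lemma mul_toWord_of {g h : FG k} (hh : ∀ x ∈ g.toWord.getLast?, ∀ y ∈ h.toWord.head?, y ≠ linv x) :
    (g * h).toWord = g.toWord ++ h.toWord := by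
  rw [← mk_toWord_of_red (red_append FreeGroup.isReduced_toWord FreeGroup.isReduced_toWord hh),
    ← FreeGroup.mul_mk, FreeGroup.mk_toWord, FreeGroup.mk_toWord]

lemma eq_of_toWord_append {g h : FG k} {t : List (Letter k)} (ht : h.toWord = g.toWord ++ t) :
    (g⁻¹ * h).toWord = t := by
  have h1 : FreeGroup.IsReduced t := (red_append_iff.1 (ht ▸ FreeGroup.isReduced_toWord)).2.1
  rw [← mk_toWord_of_red h1]
  congr 1
  rw [inv_mul_eq_iff_eq_mul]
  conv_rhs => rw [← FreeGroup.mk_toWord (x := g)]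
  rw [FreeGroup.mul_mk, ← ht, FreeGroup.mk_toWord]

lemma mem_cone_iff {g h : FG k} {l : List (Letter k)} {x : Letter k} (hg : g.toWord = l ++ [x]) :
    h ∈ cone g ↔ g⁻¹ * h ∉ Sset {linv x} := by
  constructor
  · rintro ⟨t, ht⟩
    have := eq_of_toWord_append ht.symm
    rintro ⟨y, hy, hy2⟩
    rw [this] at hy2
    have hr : FreeGroup.IsReduced (g.toWord ++ t) := ht ▸ FreeGroup.isReduced_toWord
    rw [red_append_iff] at hr
    exact hr.2.2 x (by simp [hg]) y hy2 hy
  · intro hn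
    have := mul_toWord_of (g := g) (h := g⁻¹ * h) (by
      intro a ha y hy
      rw [hg] at ha
      simp at ha
      subst ha
      intro hc
      exact hn ⟨y, hc, hy⟩)
    refine ⟨(g⁻¹ * h).toWord, ?_⟩
    rw [← this]
    simp

lemma toWord_mul_lt {g : FG k} {l : List (Letter k)} {x y : Letter k} (hg : g.toWord = l ++ [x])
    (hy : y ≠ linv x) : (g * lt y).toWord = g.toWord ++ [y] := by
  rw [mul_toWord_of, toWord_lt]
  simpa [hg, toWord_lt] using hy

lemma toWord_lt_pow (x : Letter k) (n : ℕ) : (lt x ^ n).toWord = List.replicate n x := by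
  rw [FreeGroup.toWord_pow, toWord_lt]
  simp [FreeGroup.reduce_replicate]

/-- almost right invariant sets -/
def AI (E : Set (FG k)) : Prop := ∀ x : FG k, {g | ¬ (g ∈ E ↔ g * x ∈ E)}.Finite

lemma finite_len (n : ℕ) : {g : FG k | g.toWord.length ≤ n}.Finite := by
  refine Set.Finite.of_injOn (f := FreeGroup.toWord) (t := {l : List (Letter k) | l.length ≤ n})
    (fun g hg => hg) (FreeGroup.toWord_injective.injOn) ?_
  exact List.finite_length_le _ _

lemma AI_Sset (Y : Set (Letter k)) : AI (Sset Y) := by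
  intro x
  refine (finite_len x.toWord.length).subset ?_
  intro g hg
  by_contra hc
  simp only [Set.mem_ofPred_eq, not_le] at hc
  apply hg
  simp only [Sset, Set.mem_ofPred_eq, hd_mul g x hc]

/-- letters whose positive ray ends in `E` -/
def YE (E : Set (FG k)) : Set (Letter k) := {x | ∀ᶠ n : ℕ in Filter.atTop, lt x ^ n ∈ E}

structure GoodF (F : Set (FG k) → ℕ∞) : Prop where
  sub : ∀ E C, F (E ∩ C) + F (E ∪ C) ≤ F E + F C
  compl : ∀ E, F Eᶜ = F E
  fin : ∀ E E', {g | ¬ (g ∈ E ↔ g ∈ E')}.Finite → F E = F E'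
  tr : ∀ E (g : FG k), AI E → F {h | g * h ∈ E} = F E

variable {F : Set (FG k) → ℕ∞} {D : Letter k → ℕ}

lemma step_union (hF : GoodF F)
    (hD1 : ∀ x Y, x ∈ Y → linv x ∉ Y → (D x : ℕ∞) ≤ F (Sset Y))
    (hD2 : ∀ x, F (Sset {x}) ≤ D x) (hD3 : ∀ x, D (linv x) = D x)
    {g : FG k} {l : List (Letter k)} {x : Letter k} (hg : g.toWord = l ++ [x])
    (E : Set (FG k)) (hE : ∀ y, y ≠ linv x → ∀ h ∈ cone (g * lt y), h ∈ E ↔ g * lt y ∈ E)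
    (hx : g * lt x ∈ E) : F (E ∪ cone g) ≤ F E := by
  set Y : Set (Letter k) := {y | y ≠ linv x ∧ g * lt y ∈ E} with hY
  have h1 : F (E ∩ cone g) = F {h | g⁻¹ * h ∈ Sset Y} := by
    apply hF.fin
    refine (Set.finite_singleton g).subset ?_
    intro h hh
    by_contra hne
    apply hh
    simp only [Set.mem_singleton_iff] at hne
    rw [Set.mem_inter_iff, mem_cone_iff hg]
    have hne' : g⁻¹ * h ≠ 1 := by
      intro hc; apply hne; rw [inv_mul_eq_one] at hc; exact hc.symm
    obtain ⟨y, t, ht⟩ : ∃ y t, (g⁻¹ * h).toWord = y :: t := by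
      cases hw : (g⁻¹ * h).toWord with
      | nil => exact absurd (FreeGroup.toWord_eq_nil_iff.1 hw) hne'
      | cons y t => exact ⟨y, t, rfl⟩
    have e1 : g⁻¹ * h ∈ Sset {linv x} ↔ y = linv x := mem_Sset_of (by simp [ht])
    have e2 : g⁻¹ * h ∈ Sset Y ↔ y ∈ Y := mem_Sset_of (by simp [ht])
    simp only [Set.mem_ofPred_eq]
    rw [e1, e2, hY]
    simp only [Set.mem_ofPred_eq]
    constructor
    · rintro ⟨ha, hb⟩
      refine ⟨hb, ?_⟩
      rw [← hE y hb h ?_]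
      · exact ha
      have hc : h ∈ cone g := by rw [mem_cone_iff hg, e1]; exact hb
      obtain ⟨s, hs⟩ := hc
      refine ⟨t, ?_⟩
      rw [toWord_mul_lt hg hb, ← hs, ← eq_of_toWord_append hs.symm, ht]; simp
    · rintro ⟨hb, ha⟩
      refine ⟨?_, hb⟩
      rw [hE y hb h ?_]
      · exact ha
      have hc : h ∈ cone g := by rw [mem_cone_iff hg, e1]; exact hb
      obtain ⟨s, hs⟩ := hc
      refine ⟨t, ?_⟩
      rw [toWord_mul_lt hg hb, ← hs, ← eq_of_toWord_append hs.symm, ht]; simp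
  have h2 : F (cone g) ≤ D x := by
    have : (cone g) = {h | g⁻¹ * h ∈ Sset {linv x}}ᶜ := by
      ext h; rw [mem_cone_iff hg]; rfl
    rw [this, hF.compl, hF.tr _ _ (AI_Sset _), ← hD3]
    exact hD2 _
  have h3 : (D x : ℕ∞) ≤ F (E ∩ cone g) := by
    rw [h1, hF.tr _ _ (AI_Sset _)]
    exact hD1 x Y ⟨(linv_ne x).symm, hx⟩ (fun h => h.1 rfl)
  have h4 := hF.sub E (cone g)
  have h5 : (D x : ℕ∞) + F (E ∪ cone g) ≤ D x + F E := by
    calc _ ≤ F (E ∩ cone g) + F (E ∪ cone g) := by gcongr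
      _ ≤ F E + F (cone g) := h4
      _ ≤ F E + D x := by gcongr
      _ = _ := add_comm _ _
  exact (ENat.add_le_add_iff_left (ENat.natCast_ne_top _)).1 h5

lemma main_ind (hF : GoodF F)
    (hD1 : ∀ x Y, x ∈ Y → linv x ∉ Y → (D x : ℕ∞) ≤ F (Sset Y))
    (hD2 : ∀ x, F (Sset {x}) ≤ D x) (hD3 : ∀ x, D (linv x) = D x) (n : ℕ) :
    ∀ K : Finset (FG k), K.card = n → 1 ∈ K →
      (∀ g ∈ K, ∀ h : FG k, h.toWord <+: g.toWord → h ∈ K) →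
      ∀ E : Set (FG k), (∀ h ∉ K, ∀ h' ∈ cone h, (h' ∈ E ↔ h ∈ E)) →
      F (Sset (YE E)) ≤ F E := by
  induction n with
  | zero =>
    intro K hK h1
    rw [Finset.card_eq_zero] at hK
    simp [hK] at h1
  | succ n ih =>
    intro K hK h1 hpre E hE
    by_cases hK1 : K = {1}
    · apply le_of_eq
      apply hF.fin
      refine (Set.finite_singleton 1).subset ?_
      intro h hh
      by_contra hne
      apply hh
      obtain ⟨y, t, ht⟩ : ∃ y t, h.toWord = y :: t := by
        cases hw : h.toWord with
        | nil => exact absurd (FreeGroup.toWord_eq_nil_iff.1 hw) hne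
        | cons y t => exact ⟨y, t, rfl⟩
      have hy : lt y ∉ K := by
        rw [hK1, Finset.mem_singleton, ← FreeGroup.toWord_eq_nil_iff, toWord_lt]; simp
      have e1 := hE _ hy h (by simp [cone, toWord_lt, ht])
      rw [e1]
      have e2 : ∀ n : ℕ, 1 ≤ n → (lt y ^ n ∈ E ↔ lt y ∈ E) := by
        intro n hn
        apply hE _ hy
        obtain ⟨m, rfl⟩ : ∃ m, n = m + 1 := ⟨n - 1, by omega⟩
        simp [cone, toWord_lt, toWord_lt_pow, List.replicate_succ]
      have e3 : h ∈ Sset (YE E) ↔ y ∈ YE E := mem_Sset_of (by simp [ht])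
      rw [e3]
      constructor
      · intro hy
        obtain ⟨n, hn, hn2⟩ := (hy.and (Filter.eventually_ge_atTop 1)).exists
        exact (e2 n hn2).1 hn
      · intro hy
        filter_upwards [Filter.eventually_ge_atTop 1] with n hn
        exact (e2 n hn).2 hy
    · obtain ⟨g, hgK, hmax⟩ := Finset.exists_max_image K (fun g => g.toWord.length) ⟨1, h1⟩
      have hg1 : g ≠ 1 := by
        rintro rfl
        apply hK1
        ext h
        rw [Finset.mem_singleton]
        constructor
        · intro hh
          have := hmax h hh
          simp at this
          exact this
        · rintro rfl; exact h1
      obtain ⟨l, x, hg⟩ : ∃ l x, g.toWord = l ++ [x] := by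
        rcases List.eq_nil_or_concat g.toWord with h | ⟨l, x, h⟩
        · exact absurd (FreeGroup.toWord_eq_nil_iff.1 h) hg1
        · exact ⟨l, x, by simpa using h⟩
      have hout : ∀ y, y ≠ linv x → g * lt y ∉ K := by
        intro y hy hc
        have := hmax _ hc
        rw [toWord_mul_lt hg hy] at this
        simp at this
      have hcard : (K.erase g).card = n := by rw [Finset.card_erase_of_mem hgK, hK]; rfl
      have h1' : 1 ∈ K.erase g := Finset.mem_erase.2 ⟨hg1.symm, h1⟩
      have hpre' : ∀ g' ∈ K.erase g, ∀ h : FG k, h.toWord <+: g'.toWord → h ∈ K.erase g := by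
        intro g' hg' h hh
        rw [Finset.mem_erase] at hg' ⊢
        refine ⟨?_, hpre _ hg'.2 _ hh⟩
        rintro rfl
        apply hg'.1
        apply FreeGroup.toWord_injective
        exact (hh.eq_of_length_le (hmax _ hg'.2)).symm
      have hcc : ∀ h ∉ K, ∀ h' ∈ cone h, (h' ∈ cone g ↔ h ∈ cone g) := by
        intro h hh h' hh'
        constructor
        · intro h2
          rcases List.prefix_or_prefix_of_prefix hh' h2 with h3 | h3
          · exact absurd (hpre _ hgK _ h3) hh
          · exact h3
        · intro h2; exact h2.trans hh'
      have hray : ∀ y : Letter k, ∀ n : ℕ, g.toWord.length < n → lt y ^ n ∈ cone g →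
          (lt y ^ n ∈ E ↔ g * lt x ∈ E) := by
        intro y n hn hc
        apply hE _ (hout x (linv_ne x).symm)
        have h2 : x = y := by
          have : x ∈ (lt y ^ n).toWord := hc.subset (by simp [hg])
          rw [toWord_lt_pow] at this
          exact List.eq_of_mem_replicate this
        subst h2
        have h3 : g.toWord = List.replicate g.toWord.length x := by
          have := hc
          simp only [cone, Set.mem_ofPred_eq, toWord_lt_pow] at this
          rw [List.eq_replicate_iff]
          exact ⟨rfl, fun b hb => List.eq_of_mem_replicate (this.subset hb)⟩
        simp only [cone, Set.mem_ofPred_eq]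
        rw [toWord_mul_lt hg (linv_ne x).symm, toWord_lt_pow, h3]
        refine ⟨List.replicate (n - (g.toWord.length + 1)) x, ?_⟩
        rw [← List.replicate_succ', ← List.replicate_add]
        congr 1; omega
      by_cases hx : g * lt x ∈ E
      · have s1 := step_union hF hD1 hD2 hD3 hg E (fun y hy => hE _ (hout y hy)) hx
        have s2 := ih (K.erase g) hcard h1' hpre' (E ∪ cone g) (by
          intro h hh h' hh'
          by_cases hhg : h = g
          · subst hhg
            have : h ∈ cone h := List.prefix_refl _
            simp [this, hh']
          · have hhK : h ∉ K := fun hc => hh (Finset.mem_erase.2 ⟨hhg, hc⟩)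
            rw [Set.mem_union, Set.mem_union, hE h hhK h' hh', hcc h hhK h' hh'])
        have s3 : YE (E ∪ cone g) = YE E := by
          ext y
          apply Filter.eventually_congr
          filter_upwards [Filter.eventually_gt_atTop g.toWord.length] with n hn
          have := hray y n hn
          simp only [Set.mem_union]
          tauto
        rw [s3] at s2
        exact s2.trans s1
      · have s1 := step_union hF hD1 hD2 hD3 hg Eᶜ
          (fun y hy h hh => not_congr (hE _ (hout y hy) h hh)) hx
        have s4 : (Eᶜ ∪ cone g) = (E \ cone g)ᶜ := by
          ext h; simp only [Set.mem_union, Set.mem_compl_iff, Set.mem_sdiff]; tauto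
        rw [s4, hF.compl, hF.compl] at s1
        have s2 := ih (K.erase g) hcard h1' hpre' (E \ cone g) (by
          intro h hh h' hh'
          by_cases hhg : h = g
          · subst hhg
            have : h ∈ cone h := List.prefix_refl _
            simp [this, hh']
          · have hhK : h ∉ K := fun hc => hh (Finset.mem_erase.2 ⟨hhg, hc⟩)
            rw [Set.mem_sdiff, Set.mem_sdiff, hE h hhK h' hh', hcc h hhK h' hh'])
        have s3 : YE (E \ cone g) = YE E := by
          ext y
          apply Filter.eventually_congr
          filter_upwards [Filter.eventually_gt_atTop g.toWord.length] with n hn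
          have := hray y n hn
          simp only [Set.mem_sdiff]
          tauto
        rw [s3] at s2
        exact s2.trans s1

lemma main_AI (hF : GoodF F)
    (hD1 : ∀ x Y, x ∈ Y → linv x ∉ Y → (D x : ℕ∞) ≤ F (Sset Y))
    (hD2 : ∀ x, F (Sset {x}) ≤ D x) (hD3 : ∀ x, D (linv x) = D x)
    (E : Set (FG k)) (hE : AI E) : F (Sset (YE E)) ≤ F E := by
  obtain ⟨N, hN⟩ : ∃ N : ℕ, ∀ g : FG k, N < g.toWord.length → ∀ x : Letter k,
      (g ∈ E ↔ g * lt x ∈ E) := by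
    have hfin : (⋃ x : Letter k, {g | ¬ (g ∈ E ↔ g * lt x ∈ E)}).Finite :=
      Set.finite_iUnion fun x => hE _
    obtain ⟨N, hN⟩ := (hfin.image fun g => g.toWord.length).bddAbove
    refine ⟨N, fun g hg x => ?_⟩
    by_contra hc
    have := hN (Set.mem_image_of_mem _ (Set.mem_iUnion.2 ⟨x, hc⟩))
    exact absurd this (by simpa using hg)
  have key : ∀ t : List (Letter k), ∀ h h' : FG k, N < h.toWord.length →
      h'.toWord = h.toWord ++ t → (h' ∈ E ↔ h ∈ E) := by
    intro t
    induction t using List.reverseRecOn with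
    | nil => intro h h' _ e; rw [List.append_nil] at e; rw [FreeGroup.toWord_injective e]
    | append_singleton t y ih =>
      intro h h' hh e
      rw [← List.append_assoc] at e
      have hr : FreeGroup.IsReduced (h.toWord ++ t) :=
        (red_append_iff.1 (e ▸ FreeGroup.isReduced_toWord (x := h'))).1
      have e1 := mk_toWord_of_red hr
      have e2 : h' = FreeGroup.mk (h.toWord ++ t) * lt y := by
        rw [lt, FreeGroup.mul_mk, ← e, FreeGroup.mk_toWord]
      rw [← ih h _ hh e1, e2]
      apply (hN _ _ _).symm
      rw [e1, List.length_append]; omega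
  refine main_ind hF hD1 hD2 hD3 _ (finite_len N).toFinset rfl (by simp) ?_ E ?_
  · intro g hg h hh
    simp only [Set.Finite.mem_toFinset, Set.mem_ofPred_eq] at *
    exact hh.length_le.trans hg
  · intro h hh h' hh'
    simp only [Set.Finite.mem_toFinset, Set.mem_ofPred_eq, not_le] at hh
    obtain ⟨t, ht⟩ := hh'
    exact key t h h' hh ht.symm

end basics


section lines
variable {k : ℕ}

/-- the forward end of the line `y w^n` lies in `E` -/
def ep (w : FG k) (E : Set (FG k)) (y : FG k) : Prop :=
  ∀ᶠ n : ℕ in (Filter.hyperfilter ℕ : Filter ℕ), y * w ^ n ∈ E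

/-- the line is crossed by `E` -/
def cr (w : FG k) (E : Set (FG k)) (y : FG k) : Prop := ¬ (ep w E y ↔ ep w⁻¹ E y)

/-- number of lines crossed by `E` -/
noncomputable def fw (w : FG k) (E : Set (FG k)) : ℕ∞ :=
  Set.encard {l : FG k ⧸ Subgroup.zpowers w | cr w E l.out}

lemma ev_congr {E E' : Set (FG k)} (hE : {g | ¬ (g ∈ E ↔ g ∈ E')}.Finite) (φ : ℕ → FG k)
    (hφ : Function.Injective φ) :
    (∀ᶠ n : ℕ in (Filter.hyperfilter ℕ : Filter ℕ), φ n ∈ E) ↔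
    (∀ᶠ n : ℕ in (Filter.hyperfilter ℕ : Filter ℕ), φ n ∈ E') := by
  apply Filter.eventually_congr
  have h1 : {n | ¬ (φ n ∈ E ↔ φ n ∈ E')}.Finite := hE.preimage hφ.injOn
  have h2 := Filter.compl_mem_hyperfilter_of_finite h1
  filter_upwards [h2] with n hn
  by_contra hc
  exact hn hc

lemma inj_line {w : FG k} (hw : w ≠ 1) (y : FG k) :
    Function.Injective (fun n : ℕ => y * w ^ n) := by
  intro a b hab
  exact injective_pow_iff_not_isOfFinOrder.2 (not_isOfFinOrder_of_isMulTorsionFree hw) (mul_left_cancel hab)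

lemma ep_right {w : FG k} (hw : w ≠ 1) {E : Set (FG k)} (hE : AI E) (y : FG k) (z : ℤ) :
    ep w E (y * w ^ z) ↔ ep w E y := by
  have := ev_congr (hE (w ^ z)) _ (inj_line hw y)
  unfold ep
  rw [show (∀ᶠ n : ℕ in (Filter.hyperfilter ℕ : Filter ℕ), y * w ^ n ∈ E) ↔ _ from this]
  apply Filter.eventually_congr
  filter_upwards with n
  have : y * w ^ z * w ^ n = y * w ^ n * w ^ z := by
    rw [mul_assoc, mul_assoc, ← zpow_natCast, ← zpow_add, ← zpow_add, add_comm]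
  rw [this]
  rfl

lemma cr_right {w : FG k} (hw : w ≠ 1) {E : Set (FG k)} (hE : AI E) (y : FG k) (z : ℤ) :
    cr w E (y * w ^ z) ↔ cr w E y := by
  unfold cr
  rw [ep_right hw hE]
  have := ep_right (inv_ne_one.2 hw) hE y (-z)
  rw [inv_zpow, zpow_neg, inv_inv] at this
  rw [this]

lemma cr_out {w : FG k} (hw : w ≠ 1) {E : Set (FG k)} (hE : AI E) (y : FG k) :
    cr w E (QuotientGroup.mk y : FG k ⧸ Subgroup.zpowers w).out ↔ cr w E y := by
  obtain ⟨⟨h, z, hz⟩, hh⟩ := QuotientGroup.mk_out_eq_mul (Subgroup.zpowers w) y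
  rw [hh]
  simp only at hz ⊢
  rw [← hz]
  exact cr_right hw hE y z

lemma AI_tr {E : Set (FG k)} (hE : AI E) (g : FG k) : AI {h | g * h ∈ E} := by
  intro x
  have := (hE x).preimage (f := fun h => g * h) (mul_right_injective g).injOn
  refine this.subset ?_
  intro h hh
  simpa [mul_assoc] using hh

lemma good_fw {w : FG k} (hw : w ≠ 1) : GoodF (fw w) where
  sub := by
    intro E C
    have h1 : ∀ y, ep w (E ∩ C) y ↔ ep w E y ∧ ep w C y := fun y => Filter.eventually_and
    have h2 : ∀ y, ep w (E ∪ C) y ↔ ep w E y ∨ ep w C y := fun y => Ultrafilter.eventually_or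
    have h3 : ∀ y, ep w⁻¹ (E ∩ C) y ↔ ep w⁻¹ E y ∧ ep w⁻¹ C y := fun y => Filter.eventually_and
    have h4 : ∀ y, ep w⁻¹ (E ∪ C) y ↔ ep w⁻¹ E y ∨ ep w⁻¹ C y := fun y => Ultrafilter.eventually_or
    unfold fw
    rw [← Set.encard_union_add_encard_inter, ← Set.encard_union_add_encard_inter {l | cr w E _}]
    apply add_le_add
    · apply Set.encard_mono
      intro l hl
      simp only [Set.mem_union, Set.mem_ofPred_eq, cr, h1, h2, h3, h4] at hl ⊢
      tauto
    · apply Set.encard_mono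
      intro l hl
      simp only [Set.mem_inter_iff, Set.mem_ofPred_eq, cr, h1, h2, h3, h4] at hl ⊢
      tauto
  compl := by
    intro E
    have h1 : ∀ v y, ep v Eᶜ y ↔ ¬ ep v E y := fun v y => Ultrafilter.eventually_not
    unfold fw
    congr 1
    ext l
    simp only [Set.mem_ofPred_eq, cr, h1]
    tauto
  fin := by
    intro E E' h
    have h1 : ∀ v : FG k, v ≠ 1 → ∀ y, ep v E y ↔ ep v E' y :=
      fun v hv y => ev_congr h _ (inj_line hv y)
    unfold fw
    congr 1
    ext l
    simp only [Set.mem_ofPred_eq, cr, h1 w hw, h1 w⁻¹ (inv_ne_one.2 hw)]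
  tr := by
    intro E g hE
    unfold fw
    have h0 : ∀ y, cr w {h | g * h ∈ E} y ↔ cr w E (g * y) := by
      intro y
      simp only [cr, ep, Set.mem_ofPred_eq, mul_assoc]
    have h1 : {l : FG k ⧸ Subgroup.zpowers w | cr w {h | g * h ∈ E} l.out} =
        (MulAction.toPerm g : Equiv.Perm (FG k ⧸ Subgroup.zpowers w)) ⁻¹' {l | cr w E l.out} := by
      ext l
      induction l using QuotientGroup.induction_on with
      | H y =>
        simp only [Set.mem_ofPred_eq, Set.mem_preimage]
        rw [cr_out hw (AI_tr hE g), h0]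
        have : (MulAction.toPerm g : Equiv.Perm (FG k ⧸ Subgroup.zpowers w)) (QuotientGroup.mk y) =
          QuotientGroup.mk (g * y) := rfl
        rw [this, cr_out hw hE]
    rw [h1, Set.encard_preimage_of_bijective (Equiv.bijective _)]

lemma good_comb {w v : FG k} (hw : w ≠ 1) (hv : v ≠ 1) (M : ℕ) :
    GoodF (fun E => (M : ℕ∞) * fw w E + fw v E) where
  sub := by
    intro E C
    have h1 := (good_fw hw).sub E C
    have h2 := (good_fw hv).sub E C
    calc _ = (M : ℕ∞) * (fw w (E ∩ C) + fw w (E ∪ C)) + (fw v (E ∩ C) + fw v (E ∪ C)) := by ring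
      _ ≤ (M : ℕ∞) * (fw w E + fw w C) + (fw v E + fw v C) := by gcongr
      _ = _ := by ring
  compl := by intro E; simp only [(good_fw hw).compl, (good_fw hv).compl]
  fin := by intro E E' h; simp only [(good_fw hw).fin E E' h, (good_fw hv).fin E E' h]
  tr := by intro E g h; simp only [(good_fw hw).tr E g h, (good_fw hv).tr E g h]

lemma edge_cross {g : FG k} {r x : Letter k} (h : ¬ (g ∈ Sset {x} ↔ g * lt r ∈ Sset {x})) :
    (g = 1 ∧ r = x) ∨ (g * lt r = 1 ∧ r = linv x) := by
  by_cases h2 : 1 < g.toWord.length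
  · exfalso
    apply h
    have := hd_mul g (lt r) (by simpa [toWord_lt] using h2)
    simp only [Sset, Set.mem_ofPred_eq, this]
  · by_cases h1 : g = 1
    · subst h1
      left
      refine ⟨rfl, ?_⟩
      by_contra hc
      apply h
      rw [one_mul, mem_Sset_of (g := lt r) (y := r) (by simp [toWord_lt])]
      simp [Sset, hc]
    · obtain ⟨s, hs⟩ : ∃ s, g.toWord = [s] := by
        rw [← List.length_eq_one_iff]
        have : g.toWord.length ≠ 0 := by simpa using h1
        omega
      have hg : g = lt s := by apply FreeGroup.toWord_injective; rw [hs, toWord_lt]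
      right
      by_cases hr : r = linv s
      · subst hr
        rw [hg, lt_linv, mul_inv_cancel] at h ⊢
        refine ⟨rfl, ?_⟩
        by_contra hc
        apply h
        rw [mem_Sset_of (y := s) (by simp [toWord_lt])]
        have : s ≠ x := fun e => hc (by rw [e])
        simp [Sset, this]
      · exfalso
        apply h
        have := toWord_mul_lt (g := g) (l := []) (x := s) (by simpa using hs) hr
        simp only [Sset, Set.mem_ofPred_eq, this, hs]
        simp

/-- number of letters `x^{±1}` -/
def nc (L : List (Letter k)) (x : Letter k) : ℕ := L.countP (fun y => y.1 = x.1)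

lemma countP_eq_card {β : Type*} (L : List β) (p : β → Bool) :
    L.countP p = (Finset.univ.filter fun i : Fin L.length => p L[i] = true).card := by
  have h0 := Fin.univ_val_map (fun i : Fin L.length => L[i])
  have h1 : (L : Multiset β) = Finset.univ.val.map (fun i : Fin L.length => L[i]) := by
    rw [h0]; congr 1; exact (List.ofFn_getElem (xs := L)).symm
  have h2 := Multiset.coe_countP (fun b => p b = true) L
  rw [h1, Multiset.countP_map] at h2
  rw [Finset.card_def, Finset.filter_val, h2]
  congr 1
  funext b
  simp

lemma fw_upper {w : FG k} (hw : w ≠ 1) (α : MulAut (FG k)) (z : FG k) (R : List (Letter k))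
    (hR : α w = z * FreeGroup.mk R * z⁻¹) (h : FG k) (x : Letter k) :
    fw w {g | h * α g ∈ Sset {x}} ≤ nc R x := by
  classical
  set u := FreeGroup.mk R with hu
  have hu1 : u ≠ 1 := by
    intro hc
    rw [hc] at hR
    simp at hR
    exact hw hR
  have hpow : ∀ n : ℤ, α (w ^ n) = z * u ^ n * z⁻¹ := by
    intro n; rw [map_zpow, hR, conj_zpow]
  let G : Fin R.length → FG k := fun p =>
    α.symm (h⁻¹ * (FreeGroup.mk (R.take (if R[p] = x then p else p + 1)))⁻¹ * z⁻¹)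
  have hsub : {l : FG k ⧸ Subgroup.zpowers w | cr w {g | h * α g ∈ Sset {x}} l.out} ⊆
      ((Finset.univ.filter fun p : Fin R.length => decide (R[p].1 = x.1) = true).image
        (fun p => (QuotientGroup.mk (G p) : FG k ⧸ Subgroup.zpowers w)) : Finset _) := by
    intro l hl
    rw [Set.mem_ofPred_eq] at hl
    set y := l.out with hy
    have hly : l = QuotientGroup.mk y := (QuotientGroup.out_eq' l).symm
    set T := h * α y * z with hT
    have claim : ∃ n : ℤ, ∃ p : Fin R.length, ¬ (T * u ^ n * FreeGroup.mk (R.take p) ∈ Sset {x} ↔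
        T * u ^ n * FreeGroup.mk (R.take p) * lt R[p] ∈ Sset {x}) := by
      by_contra hc
      push Not at hc
      have c1 : ∀ n : ℤ, ∀ q : ℕ, q ≤ R.length →
          (T * u ^ n ∈ Sset {x} ↔ T * u ^ n * FreeGroup.mk (R.take q) ∈ Sset {x}) := by
        intro n q
        induction q with
        | zero => intro _; simp [← FreeGroup.one_eq_mk]
        | succ q ih =>
          intro hq
          rw [ih (by omega), hc n ⟨q, by omega⟩]
          simp only [Fin.getElem_fin]
          rw [mul_assoc _ _ (lt _), lt, FreeGroup.mul_mk, List.take_append_getElem]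
      have c2 : ∀ n : ℤ, (T * u ^ n ∈ Sset {x} ↔ T * u ^ (n + 1) ∈ Sset {x}) := by
        intro n
        rw [c1 n R.length le_rfl, List.take_length, ← hu, zpow_add_one, mul_assoc]
      have c3 : ∀ n : ℤ, (T * u ^ n ∈ Sset {x} ↔ T ∈ Sset {x}) := by
        intro n
        induction n using Int.induction_on with
        | zero => simp
        | succ n ih => rw [← c2, ih]
        | pred n ih => rw [c2, sub_add_cancel, ih]
      have c4 : ∀ v : FG k, ∀ u' : FG k, u' ≠ 1 → (∀ n : ℕ, α (v ^ n) = z * u' ^ n * z⁻¹) →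
          (∀ n : ℕ, (T * u' ^ n ∈ Sset {x} ↔ T ∈ Sset {x})) →
          (ep v {g | h * α g ∈ Sset {x}} y ↔ T ∈ Sset {x}) := by
        intro v u' hu' hp hc'
        have := ev_congr (AI_Sset {x} z⁻¹) _ (inj_line hu' T)
        unfold ep
        have e1 : (∀ᶠ n : ℕ in (Filter.hyperfilter ℕ : Filter ℕ),
            y * v ^ n ∈ {g | h * α g ∈ Sset {x}}) ↔
            (∀ᶠ n : ℕ in (Filter.hyperfilter ℕ : Filter ℕ), T * u' ^ n * z⁻¹ ∈ Sset {x}) := by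
          apply Filter.eventually_congr
          filter_upwards with n
          simp only [Set.mem_ofPred_eq, map_mul, hp n, hT, mul_assoc]
        rw [e1]
        refine Iff.trans this.symm ?_
        simp only [hc', Filter.eventually_const]
      apply hl
      rw [c4 w u hu1 (fun n => by exact_mod_cast hpow n) (fun n => by exact_mod_cast c3 n),
        c4 w⁻¹ u⁻¹ (inv_ne_one.2 hu1) (fun n => by
          have := hpow (-n)
          rwa [zpow_neg, zpow_neg, zpow_natCast, zpow_natCast, ← inv_pow, ← inv_pow] at this)
          (fun n => by
          have := c3 (-n)
          rwa [zpow_neg, zpow_natCast, ← inv_pow] at this)]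
    obtain ⟨n, p, hnp⟩ := claim
    rw [Finset.coe_image]
    have fin : ∀ q, T * u ^ n * FreeGroup.mk (R.take q) = 1 →
        l = QuotientGroup.mk (α.symm (h⁻¹ * (FreeGroup.mk (R.take q))⁻¹ * z⁻¹)) := by
      intro q hq
      rw [hly, QuotientGroup.eq]
      refine ⟨n, ?_⟩
      simp only
      rw [eq_inv_mul_iff_mul_eq]
      apply α.injective
      rw [MulEquiv.apply_symm_apply, map_mul, hpow]
      rw [mul_eq_one_iff_eq_inv] at hq
      rw [← hq, hT]
      group
    rcases edge_cross hnp with ⟨h1, h2⟩ | ⟨h1, h2⟩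
    · refine ⟨p, by have := congrArg Prod.fst h2; simpa using this, ?_⟩
      simp only [G, h2, if_true]
      exact (fin _ h1).symm
    · refine ⟨p, by have := congrArg Prod.fst h2; simpa [linv] using this, ?_⟩
      have : ¬ (R[p] = x) := by rw [h2]; exact linv_ne x
      simp only [G, this, if_false]
      refine (fin _ ?_).symm
      rw [← h1, lt, mul_assoc _ _ (FreeGroup.mk [_]), FreeGroup.mul_mk]
      simp only [Fin.getElem_fin, List.take_append_getElem]
  calc fw w {g | h * α g ∈ Sset {x}} ≤ _ := Set.encard_mono hsub
    _ ≤ _ := by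
      rw [Set.encard_coe_eq_coe_finsetCard, nc, countP_eq_card]
      exact_mod_cast Finset.card_image_le

end lines


section cutsec
variable {k : ℕ}

/-- cyclically reduced words -/
def CR (L : List (Letter k)) : Prop := FreeGroup.IsReduced (L ++ L)

lemma CR_iff {L : List (Letter k)} : CyclicallyReducedWord L ↔ CR L := by
  unfold CyclicallyReducedWord CR
  rw [FreeGroup.isReduced_iff_reduce_eq]

lemma CR.red {L : List (Letter k)} (h : CR L) : FreeGroup.IsReduced L := (red_append_iff.1 h).1

lemma CR.cyc {L : List (Letter k)} (h : CR L) : FreeGroup.IsCyclicallyReduced L := by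
  refine ⟨h.red, ?_⟩
  intro a ha b hb
  exact ne_linv_iff.1 ((red_append_iff.1 h).2.2 a ha b hb)

lemma CR_of_cyc {L : List (Letter k)} (h : FreeGroup.IsCyclicallyReduced L) : CR L := by
  refine red_append h.1 h.1 ?_
  intro a ha b hb
  exact ne_linv_iff.2 (h.2 a ha b hb)

lemma CR.toWord {L : List (Letter k)} (h : CR L) : (FreeGroup.mk L).toWord = L :=
  mk_toWord_of_red h.red

lemma CR.toWord_pow {L : List (Letter k)} (h : CR L) (n : ℕ) :
    (FreeGroup.mk L ^ n).toWord = (List.replicate n L).flatten := by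
  rw [FreeGroup.toWord_pow, h.toWord, (h.cyc.flatten_replicate n).isReduced.reduce_eq]

lemma CR.comm {A B : List (Letter k)} (h : CR (A ++ B)) : CR (B ++ A) := by
  have := (h.cyc.flatten_replicate 3).isReduced
  refine this.infix ⟨A, B, ?_⟩
  simp [List.replicate]

lemma CR.invRev {L : List (Letter k)} (h : CR L) : CR (FreeGroup.invRev L) := by
  have h1 : (FreeGroup.mk (L ++ L))⁻¹.toWord = FreeGroup.invRev (L ++ L) := by
    rw [FreeGroup.toWord_inv, mk_toWord_of_red h]
  have h2 : FreeGroup.invRev (L ++ L) = FreeGroup.invRev L ++ FreeGroup.invRev L := by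
    simp [FreeGroup.invRev]
  unfold CR
  rw [← h2, ← h1]
  exact FreeGroup.isReduced_toWord

lemma ray {R : List (Letter k)} (hR : CR R) (h0 : R ≠ []) (h : FG k) :
    ∀ᶠ n : ℕ in Filter.atTop, (FreeGroup.mk R ^ n * h).toWord.head? = R.head? := by
  filter_upwards [Filter.eventually_gt_atTop h.toWord.length] with n hn
  have hl : 0 < R.length := List.length_pos_iff.2 h0
  rw [hd_mul, hR.toWord_pow, List.head?_flatten_replicate (by omega)]
  rw [hR.toWord_pow]
  simp
  nlinarith

lemma head_invRev (R : List (Letter k)) : (FreeGroup.invRev R).head? = R.getLast?.map linv := by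
  rw [FreeGroup.invRev, List.head?_reverse, List.getLast?_map]
  rfl

lemma ep_ray {R : List (Letter k)} (hR : CR R) {b : Letter k} (hb : R.head? = some b) {w y h : FG k}
    (hy : ∀ n : ℕ, y * w ^ n = FreeGroup.mk R ^ n * h) (Y : Set (Letter k)) :
    ep w (Sset Y) y ↔ b ∈ Y := by
  have h0 : R ≠ [] := by rintro rfl; simp at hb
  have h1 : ∀ᶠ n : ℕ in (Filter.hyperfilter ℕ : Filter ℕ), (y * w ^ n ∈ Sset Y ↔ b ∈ Y) := by
    apply Nat.hyperfilter_le_atTop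
    filter_upwards [ray hR h0 h] with n hn
    rw [hy, mem_Sset_of (hn.trans hb)]
  unfold ep
  rw [Filter.eventually_congr h1]
  simp

open Classical in
/-- the number of pairs of cyclically consecutive letters cut by `Y` -/
noncomputable def cut (Y : Set (Letter k)) (L : List (Letter k)) : ℕ :=
  (L.zip (L.rotate 1)).countP (fun p => decide (¬ (p.2 ∈ Y ↔ linv p.1 ∈ Y)))

lemma rot_head {L : List (Letter k)} (p : ℕ) (hp : p < (L.zip (L.rotate 1)).length) :
    (L.drop (p + 1) ++ L.take (p + 1)).head? = some (L.zip (L.rotate 1))[p].2 := by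
  have hpl : p < L.length := by simpa using hp
  have : L.drop (p + 1) ++ L.take (p + 1) = (L.rotate 1).rotate p := by
    rw [List.rotate_rotate, add_comm, List.rotate_eq_drop_append_take (by omega)]
  rw [this, List.head?_rotate (by simpa using hpl), List.getElem?_eq_getElem (by simpa using hpl),
    List.getElem_zip]

lemma rot_last {L : List (Letter k)} (p : ℕ) (hp : p < (L.zip (L.rotate 1)).length) :
    (L.drop (p + 1) ++ L.take (p + 1)).getLast? = some (L.zip (L.rotate 1))[p].1 := by
  have hpl : p < L.length := by simpa using hp
  have h1 : L.take (p + 1) = L.take p ++ [L[p]] := by rw [List.take_append_getElem]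
  rw [h1, List.getElem_zip, ← List.append_assoc, List.getLast?_concat]

lemma CR.pair {L : List (Letter k)} (hL : CR L) : ∀ p ∈ L.zip (L.rotate 1), p.2 ≠ linv p.1 := by
  intro p hp
  obtain ⟨i, hi, rfl⟩ := List.getElem_of_mem hp
  have h1 : CR (L.drop (i + 1) ++ L.take (i + 1)) := by
    apply CR.comm; rwa [List.take_append_drop]
  exact (red_append_iff.1 h1).2.2 _ (rot_last i hi) _ (rot_head i hi)

lemma cut_le_fw {L : List (Letter k)} (hL : CR L) (h0 : L ≠ []) (Y : Set (Letter k)) :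
    (cut Y L : ℕ∞) ≤ fw (FreeGroup.mk L) (Sset Y) := by
  classical
  set w := FreeGroup.mk L with hw
  have hw1 : w ≠ 1 := by
    intro hc
    have := hL.toWord
    rw [← hw, hc] at this
    simp at this
    exact h0 this
  have hn : 0 < L.length := List.length_pos_iff.2 h0
  unfold cut
  rw [countP_eq_card, fw]
  set G : Fin (L.zip (L.rotate 1)).length → FG k ⧸ Subgroup.zpowers w := fun p =>
    QuotientGroup.mk (FreeGroup.mk (L.take (p + 1)))⁻¹ with hG
  have hlen : (L.zip (L.rotate 1)).length = L.length := by simp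
  have key : ∀ p p' : ℕ, p < L.length → p' < L.length → ∀ m : ℕ,
      FreeGroup.mk (L.take (p' + 1)) = w ^ m * FreeGroup.mk (L.take (p + 1)) → p' = p := by
    intro p p' hp hp' m hm
    have h1 : FreeGroup.IsReduced ((List.replicate m L).flatten ++ L.take (p + 1)) := by
      refine ((hL.cyc.flatten_replicate (m + 1)).isReduced).infix ⟨[], L.drop (p + 1), ?_⟩
      rw [List.replicate_succ']
      simp
    have h2 : w ^ m * FreeGroup.mk (L.take (p + 1)) =
        FreeGroup.mk ((List.replicate m L).flatten ++ L.take (p + 1)) := by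
      rw [← FreeGroup.mul_mk, ← hL.toWord_pow, FreeGroup.mk_toWord]
    rw [h2] at hm
    have h3 := congrArg FreeGroup.toWord hm
    rw [mk_toWord_of_red h1, mk_toWord_of_red
      (hL.red.infix ⟨[], L.drop (p' + 1), by simp⟩)] at h3
    have h4 := congrArg List.length h3
    simp at h4
    rcases Nat.eq_zero_or_pos m with rfl | hm0
    · simp at h4; omega
    · have : L.length ≤ m * L.length := Nat.le_mul_of_pos_left _ hm0
      omega
  have hinj : Function.Injective G := by
    intro p p' hpp
    simp only [hG] at hpp
    rw [QuotientGroup.eq] at hpp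
    obtain ⟨z, hz⟩ := hpp
    simp only [inv_inv] at hz
    have hp : (p : ℕ) < L.length := hlen ▸ p.2
    have hp' : (p' : ℕ) < L.length := hlen ▸ p'.2
    apply Fin.ext
    rcases Int.eq_nat_or_neg z with ⟨m, rfl | rfl⟩
    · apply key p' p hp' hp m
      rw [← zpow_natCast, hz]; group
    · refine (key p p' hp hp' m ?_).symm
      rw [zpow_neg, zpow_natCast, inv_eq_iff_eq_inv] at hz
      rw [hz]; group
  rw [← Set.encard_coe_eq_coe_finsetCard, ← hinj.encard_image]
  apply Set.encard_mono
  rintro _ ⟨p, hp, rfl⟩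
  have hpl : (p : ℕ) < L.length := hlen ▸ p.2
  simp only [Finset.coe_filter, Finset.mem_univ, true_and, Set.mem_ofPred_eq,
    decide_eq_true_eq] at hp
  rw [Set.mem_ofPred_eq, hG, cr_out hw1 (AI_Sset Y)]
  intro hc
  apply hp
  set A := L.take (p + 1) with hA
  set B := L.drop (p + 1) with hB
  have hAB : L = A ++ B := by simp [hA, hB]
  have hBA : CR (B ++ A) := by rw [hAB] at hL; exact hL.comm
  have hrot : (B ++ A).head? = some (L.zip (L.rotate 1))[p].2 := rot_head p p.2
  have hlast : (FreeGroup.invRev (B ++ A)).head? = some (linv (L.zip (L.rotate 1))[p].1) := by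
    rw [head_invRev, rot_last p p.2]
    rfl
  have hpw : ∀ n : ℤ, (FreeGroup.mk A)⁻¹ * w ^ n =
      (FreeGroup.mk (B ++ A)) ^ n * (FreeGroup.mk A)⁻¹ := by
    intro n
    have : w = FreeGroup.mk A * (FreeGroup.mk (B ++ A)) * (FreeGroup.mk A)⁻¹ := by
      rw [hw, hAB, ← FreeGroup.mul_mk, ← FreeGroup.mul_mk]; group
    rw [this, conj_zpow]; group
  have e1 := ep_ray hBA hrot (w := w) (y := (FreeGroup.mk A)⁻¹) (h := (FreeGroup.mk A)⁻¹)
    (fun n => by exact_mod_cast hpw n) Y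
  have e2 := ep_ray hBA.invRev hlast (w := w⁻¹) (y := (FreeGroup.mk A)⁻¹) (h := (FreeGroup.mk A)⁻¹)
    (fun n => by
      have := hpw (-n)
      rw [zpow_neg, zpow_neg, zpow_natCast, zpow_natCast] at this
      rw [inv_pow, ← FreeGroup.inv_mk, inv_pow, this]) Y
  rw [← e1, ← e2]
  exact hc

lemma countP_add_le {β : Type*} (l : List β) (p q r : β → Bool)
    (h : ∀ x ∈ l, (p x = true → r x = true) ∧ (q x = true → r x = true) ∧
      ¬ (p x = true ∧ q x = true)) :
    l.countP p + l.countP q ≤ l.countP r := by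
  induction l with
  | nil => simp
  | cons a l ih =>
    have := ih (fun x hx => h x (List.mem_cons_of_mem _ hx))
    have ha := h a (by simp)
    simp only [List.countP_cons]
    cases hp : p a <;> cases hq : q a <;> cases hr : r a <;> simp_all <;> omega

lemma letter_cases {x y : Letter k} (h : y.1 = x.1) : y = x ∨ y = linv x := by
  obtain ⟨a, b⟩ := x
  obtain ⟨c, d⟩ := y
  simp only at h
  subst h
  cases b <;> cases d <;> simp [linv]

lemma nc_split (L : List (Letter k)) (x : Letter k) :
    nc L x ≤ L.countP (fun y => decide (y = linv x)) + L.countP (fun y => decide (y = x)) := by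
  unfold nc
  induction L with
  | nil => simp
  | cons a l ih =>
    simp only [List.countP_cons]
    by_cases h : a.1 = x.1
    · rcases letter_cases h with rfl | rfl
      · simp; omega
      · have : (linv x).1 = x.1 := rfl
        simp [this]; omega
    · simp [h]; omega

lemma nc_linv (L : List (Letter k)) (x : Letter k) : nc L (linv x) = nc L x := rfl

lemma nc_le_cut1 {L : List (Letter k)} (hL : CR L) (x : Letter k) : nc L x ≤ cut {x} L := by
  classical
  refine (nc_split L x).trans ?_
  have e1 : L.countP (fun y => decide (y = linv x)) =
      (L.zip (L.rotate 1)).countP (fun p => decide (p.1 = linv x)) := by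
    conv_lhs => rw [← List.map_fst_zip (l₁ := L) (l₂ := L.rotate 1) (by simp), List.countP_map]
    rfl
  have e2 : L.countP (fun y => decide (y = x)) =
      (L.zip (L.rotate 1)).countP (fun p => decide (p.2 = x)) := by
    rw [← (List.rotate_perm L 1).countP_eq]
    conv_lhs => rw [← List.map_snd_zip (l₁ := L) (l₂ := L.rotate 1) (by simp), List.countP_map]
    rfl
  rw [e1, e2]
  apply countP_add_le
  intro p hp
  have := hL.pair p hp
  simp only [decide_eq_true_eq, Set.mem_singleton_iff]
  refine ⟨?_, ?_, ?_⟩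
  · intro h
    rw [h, linv_linv] at this ⊢
    simp [this]
  · intro h
    rw [h] at this ⊢
    simp [this.symm]
  · rintro ⟨h1, h2⟩
    rw [h1, h2, linv_linv] at this
    exact this rfl

lemma nc_le_cut {L : List (Letter k)} (hL : CR L) (x : Letter k) (Y : Set (Letter k))
    (hY : Y = {x} ∨ Y = {linv x}ᶜ) : nc L x ≤ cut Y L := by
  rcases hY with rfl | rfl
  · exact nc_le_cut1 hL x
  · have := nc_le_cut1 hL (linv x)
    rw [nc_linv] at this
    refine this.trans (le_of_eq ?_)
    unfold cut
    congr 1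
    funext p
    rw [decide_eq_decide]
    simp only [Set.mem_compl_iff, not_iff_not]

end cutsec


section whsec
variable {k : ℕ}

lemma wl_mul (g h : FG k) : wordLength (g * h) ≤ wordLength g + wordLength h :=
  FreeGroup.norm_mul_le g h

lemma wl_inv (g : FG k) : wordLength g⁻¹ = wordLength g := FreeGroup.norm_inv_eq

lemma icr_mk {L : List (Letter k)} (h : CR L) : IsCyclicallyReduced (FreeGroup.mk L) := by
  unfold IsCyclicallyReduced
  rw [h.toWord, CR_iff]; exact h

lemma exists_cyc (g : FG k) : ∃ (z : FG k) (L : List (Letter k)), CR L ∧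
    g = z * FreeGroup.mk L * z⁻¹ ∧ L.length ≤ wordLength g := by
  have h1 := FreeGroup.reduceCyclically.conj_conjugator_reduceCyclically g.toWord
  refine ⟨FreeGroup.mk (FreeGroup.reduceCyclically.conjugator g.toWord),
    FreeGroup.reduceCyclically g.toWord,
    CR_of_cyc (FreeGroup.reduceCyclically.isCyclicallyReduced FreeGroup.isReduced_toWord), ?_, ?_⟩
  · rw [FreeGroup.inv_mk, FreeGroup.mul_mk, FreeGroup.mul_mk, h1, FreeGroup.mk_toWord]
  · have := congrArg List.length h1
    simp only [List.length_append] at this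
    unfold wordLength
    omega

lemma CR_len_le {L L' : List (Letter k)} (h : CR L) (h' : CR L') {z : FG k}
    (hz : FreeGroup.mk L = z * FreeGroup.mk L' * z⁻¹) : L.length ≤ L'.length := by
  have h1 : ∀ n : ℕ, n * L.length ≤ n * L'.length + 2 * wordLength z := by
    intro n
    have e1 : FreeGroup.mk L ^ n = z * FreeGroup.mk L' ^ n * z⁻¹ := by rw [hz, conj_pow]
    have e2 : wordLength (FreeGroup.mk L ^ n) = n * L.length := by
      unfold wordLength; rw [h.toWord_pow]; simp
    have e3 : wordLength (FreeGroup.mk L' ^ n) = n * L'.length := by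
      unfold wordLength; rw [h'.toWord_pow]; simp
    rw [← e2, ← e3, e1]
    have := wl_mul (z * FreeGroup.mk L' ^ n) z⁻¹
    have := wl_mul z (FreeGroup.mk L' ^ n)
    have := wl_inv z
    omega
  have := h1 (2 * wordLength z + 1)
  by_contra hc
  push Not at hc
  nlinarith

lemma CR_len {L L' : List (Letter k)} (h : CR L) (h' : CR L') {z : FG k}
    (hz : FreeGroup.mk L = z * FreeGroup.mk L' * z⁻¹) : L.length = L'.length := by
  apply le_antisymm (CR_len_le h h' hz)
  apply CR_len_le h' h (z := z⁻¹)
  rw [hz]; group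

lemma cl_eq {g z : FG k} {L : List (Letter k)} (h : CR L) (hz : g = z * FreeGroup.mk L * z⁻¹) :
    cyclicLength g = L.length := by
  have : {n | ∃ x u : FG k, IsCyclicallyReduced u ∧ g = x * u * x⁻¹ ∧ wordLength u = n} =
      {L.length} := by
    ext n
    simp only [Set.mem_ofPred_eq, Set.mem_singleton_iff]
    constructor
    · rintro ⟨x, u, hu, hg, rfl⟩
      unfold wordLength
      refine CR_len (CR_iff.1 hu) h (z := x⁻¹ * z) ?_
      rw [FreeGroup.mk_toWord]
      rw [hg] at hz
      have : u = x⁻¹ * (x * u * x⁻¹) * x := by group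
      rw [this, hz]; group
    · rintro rfl
      exact ⟨z, FreeGroup.mk L, icr_mk h, hz, by unfold wordLength; rw [h.toWord]⟩
  unfold cyclicLength
  rw [this, csInf_singleton]

lemma cl_conj (g z : FG k) : cyclicLength (z * g * z⁻¹) = cyclicLength g := by
  obtain ⟨y, L, h1, h2, h3⟩ := exists_cyc g
  rw [cl_eq h1 h2, cl_eq h1 (g := z * g * z⁻¹) (z := z * y)]
  rw [h2]; group

lemma cl_le (g : FG k) : cyclicLength g ≤ wordLength g := by
  obtain ⟨y, L, h1, h2, h3⟩ := exists_cyc g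
  rw [cl_eq h1 h2]; exact h3

lemma cl_mk {L : List (Letter k)} (h : CR L) : cyclicLength (FreeGroup.mk L) = L.length :=
  cl_eq (z := 1) h (by simp)

open Classical in
/-- `A` or `1` -/
noncomputable def ee (Y : Set (Letter k)) (A : FG k) (y : Letter k) : FG k := if y ∈ Y then A else 1

/-- Whitehead endomorphism -/
noncomputable def wh (x : Letter k) (Y : Set (Letter k)) (A : FG k) : FG k →* FG k :=
  FreeGroup.lift fun i => if i = x.1 then FreeGroup.of i else
    ee Y A (i, true) * FreeGroup.of i * (ee Y A (i, false))⁻¹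

lemma lt_cases (y : Letter k) : lt y = FreeGroup.of y.1 ∧ y = (y.1, true) ∨
    lt y = (FreeGroup.of y.1)⁻¹ ∧ y = (y.1, false) := by
  obtain ⟨i, b⟩ := y
  cases b
  · right; refine ⟨?_, rfl⟩
    have := lt_linv (i, true)
    exact this
  · left; exact ⟨rfl, rfl⟩

lemma wh_same {x y : Letter k} (Y : Set (Letter k)) (A : FG k) (h : y.1 = x.1) :
    wh x Y A (lt y) = lt y := by
  rcases lt_cases y with ⟨h1, h2⟩ | ⟨h1, h2⟩ <;> rw [h1] <;> simp [wh, h]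

lemma wh_other {x y : Letter k} (Y : Set (Letter k)) (A : FG k) (h : y.1 ≠ x.1) :
    wh x Y A (lt y) = ee Y A y * lt y * (ee Y A (linv y))⁻¹ := by
  rcases lt_cases y with ⟨h1, h2⟩ | ⟨h1, h2⟩
  · rw [h1]; simp only [wh, FreeGroup.lift_apply_of, h, if_false]
    rw [h2]; rfl
  · rw [h1]; simp only [wh, FreeGroup.lift_apply_of, h, if_false, map_inv]
    rw [h2]; simp [linv, mul_assoc]

lemma wh_ee {x : Letter k} (Y : Set (Letter k)) (A : FG k) {z y : Letter k} (h : z.1 = x.1) :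
    wh x Y A (ee Y (lt z) y) = ee Y (lt z) y := by
  unfold ee; split_ifs
  · exact wh_same Y A h
  · simp

lemma wh_wh (x z : Letter k) (hz : z.1 = x.1) (Y : Set (Letter k)) :
    (wh x Y (lt (linv z))).comp (wh x Y (lt z)) = MonoidHom.id _ := by
  apply FreeGroup.ext_hom
  intro i
  have hi : (FreeGroup.of i : FG k) = lt (i, true) := rfl
  rw [hi, MonoidHom.comp_apply, MonoidHom.id_apply]
  by_cases h : i = x.1
  · rw [wh_same _ _ h, wh_same _ _ h]
  · rw [wh_other _ _ h, map_mul, map_mul, map_inv, wh_ee _ _ hz, wh_ee _ _ hz, wh_other _ _ h]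
    rw [lt_linv]
    unfold ee
    split_ifs <;> group

/-- Whitehead automorphism -/
noncomputable def whA (x : Letter k) (Y : Set (Letter k)) : MulAut (FG k) :=
  MonoidHom.toMulEquiv (wh x Y (lt x)) (wh x Y (lt (linv x))) (wh_wh x x rfl Y)
    (by have := wh_wh x (linv x) rfl Y; rwa [linv_linv] at this)

lemma whA_apply (x : Letter k) (Y : Set (Letter k)) (g : FG k) :
    whA x Y g = wh x Y (lt x) g := rfl

lemma lt_mem (x : Letter k) : lt x ∈ letterSet k := by
  rcases lt_cases x with ⟨h1, h2⟩ | ⟨h1, h2⟩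
  · exact ⟨x.1, Or.inl h1⟩
  · exact ⟨x.1, Or.inr h1⟩

lemma of_mem {g : FG k} (h : g ∈ letterSet k) : ∃ y, g = lt y := by
  obtain ⟨i, h | h⟩ := h
  · exact ⟨(i, true), h⟩
  · refine ⟨linv (i, true), ?_⟩
    rw [lt_linv, h]; rfl

lemma whA_W2 (x : Letter k) (Y : Set (Letter k)) : IsWhitehead2 (whA x Y) := by
  refine ⟨lt (linv x), lt_mem _, ?_, ?_⟩
  · rw [whA_apply]; exact wh_same _ _ rfl
  · intro g hg
    obtain ⟨y, rfl⟩ := of_mem hg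
    rw [whA_apply]
    by_cases h : y.1 = x.1
    · left; exact wh_same _ _ h
    · rw [wh_other _ _ h, lt_linv]
      unfold ee
      split_ifs <;> simp [mul_assoc]

lemma whA_lt {x : Letter k} {Y : Set (Letter k)} (hx : x ∈ Y) (hx' : linv x ∉ Y) (y : Letter k) :
    whA x Y (lt y) = ee Y (lt x) y * (if y.1 = x.1 then 1 else lt y) *
      (ee Y (lt x) (linv y))⁻¹ := by
  rw [whA_apply]
  by_cases h : y.1 = x.1
  · rw [wh_same _ _ h, if_pos h]
    rcases letter_cases h with rfl | rfl
    · simp [ee, hx, hx']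
    · simp [ee, hx, hx', linv_linv, lt_linv]
  · rw [wh_other _ _ h, if_neg h]

lemma mk_cons (a : Letter k) (l : List (Letter k)) :
    FreeGroup.mk (a :: l) = lt a * FreeGroup.mk l := by
  rw [lt, FreeGroup.mul_mk]; rfl

lemma piece {x : Letter k} (Y : Set (Letter k)) (a b : Letter k) [Decidable (¬ (b ∈ Y ↔ linv a ∈ Y))] :
    wordLength ((if a.1 = x.1 then 1 else lt a) * ((ee Y (lt x) (linv a))⁻¹ * ee Y (lt x) b)) +
      (if a.1 = x.1 then 1 else 0) ≤ 1 + (if ¬ (b ∈ Y ↔ linv a ∈ Y) then 1 else 0) := by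
  have h1 : ∀ y : Letter k, wordLength (lt y) = 1 := by
    intro y; unfold wordLength; rw [toWord_lt]; rfl
  have h0 : wordLength (1 : FG k) = 0 := by simp [wordLength]
  have h2 : wordLength ((ee Y (lt x) (linv a))⁻¹ * ee Y (lt x) b) ≤
      (if ¬ (b ∈ Y ↔ linv a ∈ Y) then 1 else 0) := by
    unfold ee
    by_cases hb : b ∈ Y <;> by_cases ha : linv a ∈ Y <;> simp [ha, hb, h0, h1, wl_inv]
  by_cases h : a.1 = x.1
  · simp only [h, if_true, one_mul]; omega
  · simp only [h, if_false]
    have := wl_mul (lt a) ((ee Y (lt x) (linv a))⁻¹ * ee Y (lt x) b)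
    rw [h1] at this
    omega

open Classical in
lemma wh_list {x : Letter k} {Y : Set (Letter k)} (hx : x ∈ Y) (hx' : linv x ∉ Y) (z : Letter k)
    (l : List (Letter k)) : ∀ a : Letter k, ∃ P : FG k,
      whA x Y (FreeGroup.mk (a :: l)) = ee Y (lt x) a * P * (ee Y (lt x) z)⁻¹ ∧
      wordLength P + nc (a :: l) x ≤ (a :: l).length +
        ((a :: l).zip (l ++ [z])).countP (fun p => decide (¬ (p.2 ∈ Y ↔ linv p.1 ∈ Y))) := by
  induction l with
  | nil =>
    intro a
    refine ⟨(if a.1 = x.1 then 1 else lt a) * ((ee Y (lt x) (linv a))⁻¹ * ee Y (lt x) z), ?_, ?_⟩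
    · have : FreeGroup.mk [a] = lt a := rfl
      rw [this, whA_lt hx hx']; group
    · have := piece (x := x) Y a z
      simpa [nc, List.countP_cons] using this
  | cons b l ih =>
    intro a
    obtain ⟨P, hP, hl⟩ := ih b
    refine ⟨(if a.1 = x.1 then 1 else lt a) * ((ee Y (lt x) (linv a))⁻¹ * ee Y (lt x) b) * P, ?_, ?_⟩
    · rw [mk_cons, map_mul, hP, whA_lt hx hx']; group
    · have h1 := piece (x := x) Y a b
      have h2 := wl_mul ((if a.1 = x.1 then 1 else lt a) *
        ((ee Y (lt x) (linv a))⁻¹ * ee Y (lt x) b)) P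
      have h3 : nc (a :: b :: l) x = nc (b :: l) x + (if a.1 = x.1 then 1 else 0) := by
        unfold nc; rw [List.countP_cons]; simp
      rw [h3, List.cons_append, List.zip_cons_cons, List.countP_cons, List.length_cons]
      simp only [decide_eq_true_eq] at hl ⊢
      omega

lemma wh_cl {x : Letter k} {Y : Set (Letter k)} (hx : x ∈ Y) (hx' : linv x ∉ Y)
    (L : List (Letter k)) (h0 : L ≠ []) :
    cyclicLength (whA x Y (FreeGroup.mk L)) + nc L x ≤ L.length + cut Y L := by
  obtain ⟨a, l, rfl⟩ := List.exists_cons_of_ne_nil h0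
  obtain ⟨P, hP, hl⟩ := wh_list hx hx' a l a
  rw [hP, cl_conj]
  have := cl_le P
  have h2 : (a :: l).rotate 1 = l ++ [a] := by simp
  unfold cut
  rw [h2]
  omega

lemma CR_two {x y : Letter k} (h : y.1 ≠ x.1) : CR [x, y] := by
  unfold CR FreeGroup.IsReduced
  simp [h, h.symm]

lemma wh_inner {x : Letter k} {Y : Set (Letter k)} (hx : x ∈ Y) (hx' : linv x ∉ Y)
    (hin : IsInner (whA x Y)) : Y = {x} ∨ Y = {linv x}ᶜ := by
  obtain ⟨c, hc⟩ := hin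
  have hcl : ∀ g, cyclicLength (whA x Y g) = cyclicLength g := by
    intro g; rw [hc, MulAut.conj_apply, cl_conj]
  have s0 : ∀ y : Letter k, y.1 ≠ x.1 → y ∈ Y → linv y ∈ Y := by
    intro y hy hyY
    by_contra hn
    have h1 : whA x Y (lt y) = FreeGroup.mk [x, y] := by
      rw [whA_apply, wh_other _ _ hy]
      simp [ee, hyY, hn, lt]
    have h2 := hcl (lt y)
    rw [h1, cl_mk (CR_two hy), lt, cl_mk (by unfold CR FreeGroup.IsReduced; simp)] at h2
    simp at h2
  have s1 : ∀ y : Letter k, y.1 ≠ x.1 → (linv y ∈ Y ↔ y ∈ Y) := by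
    intro y hy
    refine ⟨fun h => ?_, s0 y hy⟩
    have := s0 (linv y) hy h
    rwa [linv_linv] at this
  by_contra hcon
  push Not at hcon
  obtain ⟨hn1, hn2⟩ := hcon
  obtain ⟨y, hy, hyx⟩ : ∃ y ∈ Y, y.1 ≠ x.1 := by
    by_contra hcc
    push Not at hcc
    apply hn1
    ext y
    simp only [Set.mem_singleton_iff]
    refine ⟨fun hy => ?_, fun h => h ▸ hx⟩
    rcases letter_cases (hcc y hy) with h | h
    · exact h
    · rw [h] at hy; exact absurd hy hx'
  obtain ⟨z, hz, hzx⟩ : ∃ z, z ∉ Y ∧ z.1 ≠ x.1 := by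
    by_contra hcc
    push Not at hcc
    apply hn2
    ext y
    simp only [Set.mem_compl_iff, Set.mem_singleton_iff]
    refine ⟨fun hy h => hx' (h ▸ hy), fun h => ?_⟩
    by_contra hy
    rcases letter_cases (hcc y hy) with h | h
    · rw [h] at hy; exact absurd hx hy
    · contradiction
  have hyz : z.1 ≠ y.1 := by
    intro h
    rcases letter_cases h with h | h
    · rw [h] at hz; exact hz hy
    · rw [h, s1 y hyx] at hz; exact hz hy
  have hy' := (s1 y hyx).2 hy
  have hz' : linv z ∉ Y := fun h => hz ((s1 z hzx).1 h)
  have h1 : whA x Y (FreeGroup.mk [y, z]) = FreeGroup.mk [x, y, linv x, z] := by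
    simp only [mk_cons, map_mul, whA_apply, wh_other _ _ hyx, wh_other _ _ hzx]
    simp [ee, hy, hz, hy', hz', lt_linv, ← FreeGroup.one_eq_mk, mul_assoc]
  have h2 := hcl (FreeGroup.mk [y, z])
  rw [h1, cl_mk (CR_two hyz), cl_mk] at h2
  · simp at h2
  · unfold CR FreeGroup.IsReduced
    have : (linv x).1 = x.1 := rfl
    simp [hyx, hyx.symm, hzx, hzx.symm, this]

lemma SM_cut {w : FG k} (hw : w ∈ SM k) (h1 : w ≠ 1) {x : Letter k} {Y : Set (Letter k)}
    (hx : x ∈ Y) (hx' : linv x ∉ Y) (hY : ¬ (Y = {x} ∨ Y = {linv x}ᶜ)) :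
    nc w.toWord x + 1 ≤ cut Y w.toWord := by
  have h2 := hw.2 (whA x Y) (whA_W2 x Y) (fun h => hY (wh_inner hx hx' h))
  have h3 := wh_cl hx hx' w.toWord (by simpa using h1)
  rw [FreeGroup.mk_toWord] at h3
  unfold wordLength at h2
  omega

end whsec


section weaksec
variable {k : ℕ}

/-- exponent sum of the `i`-th generator -/
def exps (i : Fin k) : FG k →* Multiplicative ℤ :=
  FreeGroup.lift fun j => if j = i then Multiplicative.ofAdd 1 else 1

/-- the matrix of the abelianization -/
def abM (α : MulAut (FG k)) : Matrix (Fin k) (Fin k) ℤ :=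
  fun i j => Multiplicative.toAdd (exps i (α (FreeGroup.of j)))

lemma exps_eq (α : MulAut (FG k)) (i : Fin k) (g : FG k) :
    Multiplicative.toAdd (exps i (α g)) =
      ∑ j, abM α i j * Multiplicative.toAdd (exps j g) := by
  let f1 : FG k →* Multiplicative ℤ := (exps i).comp α.toMonoidHom
  let f2 : FG k →* Multiplicative ℤ :=
    { toFun := fun g => Multiplicative.ofAdd (∑ j, abM α i j * Multiplicative.toAdd (exps j g))
      map_one' := by simp
      map_mul' := by
        intro a b
        simp only [map_mul, toAdd_mul, mul_add, Finset.sum_add_distrib, ofAdd_add] }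
  have h : f1 = f2 := by
    apply FreeGroup.ext_hom
    intro l
    apply Multiplicative.toAdd.injective
    have e1 : f1 (FreeGroup.of l) = exps i (α (FreeGroup.of l)) := rfl
    have e2 : f2 (FreeGroup.of l) = Multiplicative.ofAdd
      (∑ j, abM α i j * Multiplicative.toAdd (exps j (FreeGroup.of l))) := rfl
    rw [e1, e2, toAdd_ofAdd, Finset.sum_eq_single l]
    · simp [abM, exps]
    · intro b _ hb
      simp [exps, hb.symm]
    · simp
  have := DFunLike.congr_fun h g
  have e1 : f1 g = exps i (α g) := rfl
  have e2 : f2 g = Multiplicative.ofAdd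
      (∑ j, abM α i j * Multiplicative.toAdd (exps j g)) := rfl
  rw [← e1, this, e2, toAdd_ofAdd]

lemma abM_mul (α : MulAut (FG k)) : abM α * abM α⁻¹ = 1 := by
  ext i l
  rw [Matrix.mul_apply]
  have := exps_eq α i (α⁻¹ (FreeGroup.of l))
  rw [MulAut.apply_inv_self] at this
  unfold abM at this ⊢
  rw [← this]
  by_cases h : i = l
  · subst h; simp [exps]
  · rw [Matrix.one_apply_ne h]; simp [exps, Ne.symm h]

lemma exists_perm (α : MulAut (FG k)) : ∃ σ : Equiv.Perm (Fin k), ∀ j, abM α (σ j) j ≠ 0 := by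
  by_contra hc
  push Not at hc
  have h0 : (abM α).det = 0 := by
    rw [Matrix.det_apply]
    apply Finset.sum_eq_zero
    intro σ _
    obtain ⟨j, hj⟩ := hc σ
    have hp : ∏ i, abM α (σ i) i = 0 := Finset.prod_eq_zero (i := j) (Finset.mem_univ j) hj
    rw [hp, smul_zero]
  have := congrArg Matrix.det (abM_mul α)
  rw [Matrix.det_mul, h0, Matrix.det_one] at this
  simp at this

lemma exps_mk (i : Fin k) (L : List (Letter k)) (h : ∀ y ∈ L, y.1 ≠ i) :
    exps i (FreeGroup.mk L) = 1 := by
  induction L with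
  | nil => rw [← FreeGroup.one_eq_mk, map_one]
  | cons a l ih =>
    rw [mk_cons, map_mul, ih (fun y hy => h y (List.mem_cons_of_mem _ hy)), mul_one]
    have := h a (by simp)
    rcases lt_cases a with ⟨h1, h2⟩ | ⟨h1, h2⟩ <;> rw [h1] <;> simp [exps, this]

lemma exists_letter {i : Fin k} {g z : FG k} {L : List (Letter k)}
    (hg : g = z * FreeGroup.mk L * z⁻¹) (h : Multiplicative.toAdd (exps i g) ≠ 0) :
    ∃ y ∈ L, y.1 = i := by
  by_contra hc
  push Not at hc
  apply h
  rw [hg, map_mul (exps i), map_mul (exps i), exps_mk i L hc]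
  simp

lemma AI_pull {E : Set (FG k)} (hE : AI E) (α : MulAut (FG k)) (h : FG k) :
    AI {g | h * α g ∈ E} := by
  intro x
  have := (hE (α x)).preimage (f := fun g => h * α g)
    ((mul_right_injective h).comp α.injective).injOn
  refine this.subset ?_
  intro g hg
  simpa [mul_assoc] using hg

lemma sep {α : MulAut (FG k)} {x y : Letter k} {z : FG k} {u1 u2 : List (Letter k)}
    (hu : CR (u1 ++ y :: u2))
    (hx : α (lt x) = z * FreeGroup.mk (u1 ++ y :: u2) * z⁻¹) :
    x ∈ YE {g | (z * FreeGroup.mk u1)⁻¹ * α g ∈ Sset {y}} ∧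
    linv x ∉ YE {g | (z * FreeGroup.mk u1)⁻¹ * α g ∈ Sset {y}} := by
  have hR : CR ((y :: u2) ++ u1) := hu.comm
  set R := (y :: u2) ++ u1 with hRdef
  have hx2 : α (lt x) = (z * FreeGroup.mk u1) * FreeGroup.mk R * (z * FreeGroup.mk u1)⁻¹ := by
    rw [hx, hRdef, ← FreeGroup.mul_mk, ← FreeGroup.mul_mk]; group
  set t := z * FreeGroup.mk u1 with ht
  have hR0 : R ≠ [] := by simp [hRdef]
  constructor
  · have := ray hR hR0 t⁻¹
    filter_upwards [this] with n hn
    rw [map_pow, hx2, conj_pow]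
    have e : t⁻¹ * (t * FreeGroup.mk R ^ n * t⁻¹) = FreeGroup.mk R ^ n * t⁻¹ := by group
    rw [e, mem_Sset_of (hn.trans (by rw [hRdef]; rfl))]
    rfl
  · intro hc
    have hi0 : FreeGroup.invRev R ≠ [] := by
      intro h
      have := congrArg List.length h
      rw [FreeGroup.invRev_length] at this
      exact hR0 (List.eq_nil_of_length_eq_zero this)
    have h1 := ray hR.invRev hi0 t⁻¹
    obtain ⟨n, hn1, hn2⟩ := (h1.and hc).exists
    rw [Set.mem_ofPred_eq, map_pow, lt_linv, map_inv, hx2] at hn2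
    have e : t⁻¹ * (t * FreeGroup.mk R * t⁻¹)⁻¹ ^ n =
        FreeGroup.mk (FreeGroup.invRev R) ^ n * t⁻¹ := by
      rw [← FreeGroup.inv_mk, inv_pow, conj_pow, inv_pow]; group
    rw [e] at hn2
    have hlast : R.getLast? = some (R.getLast hR0) := List.getLast?_eq_some_getLast hR0
    rw [head_invRev, hlast] at hn1
    rw [mem_Sset_of hn1] at hn2
    have h3 := (red_append_iff.1 hR).2.2 _ hlast y (by rw [hRdef]; rfl)
    exact h3 (Set.mem_singleton_iff.1 hn2).symm

lemma sum_nc (L : List (Letter k)) : ∑ j : Fin k, nc L (j, true) = L.length := by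
  unfold nc
  induction L with
  | nil => simp
  | cons a l ih =>
    simp only [List.countP_cons, Finset.sum_add_distrib, ih, List.length_cons]
    simp

lemma weak {w : FG k} (hw : w ∈ SM k) (hw1 : w ≠ 1) {V : List (Letter k)} (hV : CR V)
    (hV0 : V ≠ []) {α : MulAut (FG k)} {zw : FG k} (hαw : α w = zw * w * zw⁻¹) {zv : FG k}
    {R : List (Letter k)} (hR : α (FreeGroup.mk V) = zv * FreeGroup.mk R * zv⁻¹) :
    V.length ≤ R.length := by
  have hv1 : FreeGroup.mk V ≠ 1 := by
    intro hc
    have := hV.toWord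
    rw [hc] at this
    simp at this
    exact hV0 this
  have hwCR : CR w.toWord := CR_iff.1 hw.1
  have hw0 : w.toWord ≠ [] := by simpa using hw1
  set M := V.length with hM
  set D : Letter k → ℕ := fun x => M * nc w.toWord x + nc V x with hD
  have hF := good_comb hw1 hv1 M
  have cw : ∀ Y, (cut Y w.toWord : ℕ∞) ≤ fw w (Sset Y) := by
    intro Y
    have := cut_le_fw hwCR hw0 Y
    rwa [FreeGroup.mk_toWord] at this
  have cv : ∀ Y, (cut Y V : ℕ∞) ≤ fw (FreeGroup.mk V) (Sset Y) := cut_le_fw hV hV0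
  have hD1 : ∀ x Y, x ∈ Y → linv x ∉ Y → (D x : ℕ∞) ≤
      M * fw w (Sset Y) + fw (FreeGroup.mk V) (Sset Y) := by
    intro x Y hx hx'
    by_cases hY : Y = {x} ∨ Y = {linv x}ᶜ
    · have h1 := nc_le_cut hwCR x Y hY
      have h2 := nc_le_cut hV x Y hY
      have h3 : D x ≤ M * cut Y w.toWord + cut Y V := by simp only [hD]; gcongr
      calc (D x : ℕ∞) ≤ ((M * cut Y w.toWord + cut Y V : ℕ) : ℕ∞) := by exact_mod_cast h3
        _ = M * cut Y w.toWord + cut Y V := by push_cast; rfl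
        _ ≤ _ := by gcongr; exacts [cw Y, cv Y]
    · have h1 := SM_cut hw hw1 hx hx' hY
      have h2 : nc V x ≤ M := List.countP_le_length
      have h3 : D x ≤ M * cut Y w.toWord := by
        simp only [hD]
        calc _ ≤ M * nc w.toWord x + M := by omega
          _ = M * (nc w.toWord x + 1) := by ring
          _ ≤ _ := by gcongr
      calc (D x : ℕ∞) ≤ ((M * cut Y w.toWord : ℕ) : ℕ∞) := by exact_mod_cast h3
        _ = M * cut Y w.toWord := by push_cast; rfl
        _ ≤ M * fw w (Sset Y) := by gcongr; exact cw Y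
        _ ≤ _ := le_self_add
  have hD2 : ∀ x, (M * fw w (Sset {x}) + fw (FreeGroup.mk V) (Sset {x}) : ℕ∞) ≤ D x := by
    intro x
    have h1 := fw_upper hw1 1 1 w.toWord (by rw [FreeGroup.mk_toWord]; simp) 1 x
    have h2 := fw_upper hv1 1 1 V (by simp) 1 x
    have e : {g : FG k | 1 * (1 : MulAut (FG k)) g ∈ Sset {x}} = Sset {x} := by ext g; simp
    rw [e] at h1 h2
    calc _ ≤ (M * nc w.toWord x + nc V x : ℕ∞) := by gcongr
      _ = D x := by simp only [hD]; push_cast; rfl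
  have hD3 : ∀ x, D (linv x) = D x := fun x => rfl
  obtain ⟨σ, hσ⟩ := exists_perm α
  have key : ∀ j, D (j, true) ≤ M * nc w.toWord (σ j, true) + nc R (σ j, true) := by
    intro j
    obtain ⟨z, L, hL, hz, -⟩ := exists_cyc (α (FreeGroup.of j))
    obtain ⟨y, hy, hyj⟩ := exists_letter hz (hσ j)
    obtain ⟨u1, u2, rfl⟩ := List.append_of_mem hy
    obtain ⟨s1, s2⟩ := sep (α := α) (x := (j, true)) hL hz
    have h1 := main_AI hF hD1 hD2 hD3 _ (AI_pull (AI_Sset {y}) α (z * FreeGroup.mk u1)⁻¹)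
    have h2 := hD1 _ _ s1 s2
    have h3 := fw_upper hw1 α zw w.toWord (by rw [FreeGroup.mk_toWord]; exact hαw)
      (z * FreeGroup.mk u1)⁻¹ y
    have h4 := fw_upper hv1 α zv R hR (z * FreeGroup.mk u1)⁻¹ y
    have h5 : ∀ L : List (Letter k), nc L y = nc L (σ j, true) := by
      intro L; unfold nc; rw [hyj]
    rw [h5] at h3 h4
    have h6 : (D (j, true) : ℕ∞) ≤ M * nc w.toWord (σ j, true) + nc R (σ j, true) := by
      refine h2.trans (h1.trans ?_)
      gcongr
    exact_mod_cast h6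
  have hsum := Finset.sum_le_sum (s := Finset.univ) (fun j _ => key j)
  simp only [hD, Finset.sum_add_distrib, ← Finset.mul_sum] at hsum
  rw [Equiv.sum_comp σ (fun j => nc w.toWord (j, true)), Equiv.sum_comp σ (fun j => nc R (j, true)),
    sum_nc, sum_nc, sum_nc] at hsum
  omega

end weaksec


section endsec
variable {k : ℕ}

lemma cl_beta {w : FG k} (hw : w ∈ SM k) (hw1 : w ≠ 1) {α : MulAut (FG k)} {zw : FG k}
    (hαw : α w = zw * w * zw⁻¹) (g : FG k) : cyclicLength (α⁻¹ g) ≤ wordLength g := by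
  obtain ⟨y, V, hV, hy, -⟩ := exists_cyc (α⁻¹ g)
  rw [cl_eq hV hy]
  by_cases hV0 : V = []
  · simp [hV0]
  · refine weak hw hw1 hV hV0 hαw (zv := (α y)⁻¹) ?_
    have h1 := congrArg α hy
    rw [MulAut.apply_inv_self] at h1
    rw [FreeGroup.mk_toWord]
    simp only [map_mul, map_inv] at h1
    rw [h1]; group

lemma wl_one {g : FG k} (h : wordLength g = 1) : ∃ y, g = lt y := by
  obtain ⟨y, hy⟩ := List.length_eq_one_iff.1 h
  refine ⟨y, ?_⟩
  apply FreeGroup.toWord_injective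
  rw [hy, toWord_lt]

lemma wl_mk_le (L : List (Letter k)) : wordLength (FreeGroup.mk L) ≤ L.length :=
  FreeGroup.norm_mk_le

lemma wl_lt (y : Letter k) : wordLength (lt y) = 1 := by
  unfold wordLength; rw [toWord_lt]; rfl

lemma not_CR {g : FG k} (h : ¬ CR g.toWord) : ∃ y m, g.toWord = y :: (m ++ [linv y]) := by
  unfold CR at h
  rw [red_append_iff] at h
  have h0 : FreeGroup.IsReduced g.toWord := FreeGroup.isReduced_toWord
  simp only [h0, true_and] at h
  push Not at h
  obtain ⟨a, ha, b, hb, hab⟩ := h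
  obtain ⟨t, ht⟩ : ∃ t, g.toWord = b :: t := by
    cases hL : g.toWord with
    | nil => rw [hL] at hb; simp at hb
    | cons c t => rw [hL] at hb; simp at hb; exact ⟨t, by rw [hb]⟩
  rw [ht] at ha ⊢
  rcases List.eq_nil_or_concat t with rfl | ⟨m, c, rfl⟩
  · simp at ha
    rw [ha] at hab
    exact absurd hab.symm (linv_ne a)
  · refine ⟨b, m, ?_⟩
    have : c = a := by
      rw [List.concat_eq_append, ← List.cons_append, List.getLast?_concat] at ha
      simpa using ha
    rw [this, hab, linv_linv, List.concat_eq_append]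

lemma endgame (β : MulAut (FG k)) (H : ∀ g, cyclicLength (β g) ≤ wordLength g) :
    ∃ p : FG k, ∀ i, ∃ y, p⁻¹ * β (FreeGroup.of i) * p = lt y := by
  obtain ⟨p, hp⟩ : ∃ p : FG k, ∀ q : FG k, ∑ i, wordLength (p⁻¹ * β (FreeGroup.of i) * p) ≤
      ∑ i, wordLength (q⁻¹ * β (FreeGroup.of i) * q) := by
    let f : FG k → ℕ := fun p => ∑ i, wordLength (p⁻¹ * β (FreeGroup.of i) * p)
    exact ⟨Function.argmin f, fun q => Function.argmin_le f q⟩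
  refine ⟨p, ?_⟩
  by_contra hc
  push Not at hc
  obtain ⟨i, hi⟩ := hc
  set r : Fin k → FG k := fun i => p⁻¹ * β (FreeGroup.of i) * p with hr
  have hri : ∀ y, r i ≠ lt y := hi
  have hcl : ∀ g, cyclicLength (p⁻¹ * β g * p) ≤ wordLength g := by
    intro g
    have := cl_conj (β g) p⁻¹
    rw [inv_inv] at this
    rw [this]; exact H g
  have hof : ∀ j : Fin k, (FreeGroup.of j : FG k) = lt (j, true) := fun j => rfl
  have hr1 : ∀ j, r j ≠ 1 := by
    intro j hj
    simp only [hr] at hj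
    rw [mul_eq_one_iff_eq_inv, inv_mul_eq_iff_eq_mul, mul_inv_cancel] at hj
    have : (FreeGroup.of j : FG k) = 1 := β.injective (by rw [hj, map_one])
    have h2 := wl_lt (j, true)
    rw [← hof, this] at h2
    simp [wordLength] at h2
  have hrl : ∀ j, 0 < wordLength (r j) := by
    intro j
    unfold wordLength
    rw [List.length_pos_iff]
    simpa using hr1 j
  have hnCR : ¬ CR (r i).toWord := by
    intro h
    have h1 := cl_mk h
    rw [FreeGroup.mk_toWord] at h1
    have h2 := hcl (FreeGroup.of i)
    rw [hof i, wl_lt] at h2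
    have h3 := hrl i
    have : wordLength (r i) = 1 := by
      have e : cyclicLength (r i) ≤ 1 := h2
      unfold wordLength at h3 ⊢
      omega
    obtain ⟨y, hy⟩ := wl_one this
    exact hri y hy
  obtain ⟨y, m, hym⟩ := not_CR hnCR
  have hdec : wordLength ((lt y)⁻¹ * r i * lt y) < wordLength (r i) := by
    have e : r i = lt y * (FreeGroup.mk m * (lt y)⁻¹) := by
      rw [← FreeGroup.mk_toWord (x := r i), hym, mk_cons, ← FreeGroup.mul_mk, ← lt_linv]; rfl
    have e2 : (lt y)⁻¹ * r i * lt y = FreeGroup.mk m := by rw [e]; group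
    rw [e2]
    have := wl_mk_le m
    have h3 : wordLength (r i) = m.length + 2 := by unfold wordLength; rw [hym]; simp
    omega
  have hall : ∀ j, wordLength ((lt y)⁻¹ * r j * lt y) ≤ wordLength (r j) := by
    intro j
    by_cases h1 : (r j).toWord.head? = some y
    · obtain ⟨t, ht⟩ : ∃ t, (r j).toWord = y :: t := by
        cases hL : (r j).toWord with
        | nil => rw [hL] at h1; simp at h1
        | cons c t => rw [hL] at h1; simp at h1; exact ⟨t, by rw [h1]⟩
      have e : r j = lt y * FreeGroup.mk t := by
        rw [← FreeGroup.mk_toWord (x := r j), ht, mk_cons]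
      have e2 : (lt y)⁻¹ * r j * lt y = FreeGroup.mk t * lt y := by rw [e]; group
      rw [e2]
      have h2 := wl_mul (FreeGroup.mk t) (lt y)
      have h3 := wl_mk_le t
      have h4 : wordLength (r j) = t.length + 1 := by unfold wordLength; rw [ht]; simp
      rw [wl_lt] at h2
      omega
    · by_cases h2 : (r j).toWord.getLast? = some (linv y)
      · obtain ⟨t, ht⟩ := List.getLast?_eq_some_iff.1 h2
        have e : r j = FreeGroup.mk t * (lt y)⁻¹ := by
          rw [← FreeGroup.mk_toWord (x := r j), ht, ← FreeGroup.mul_mk, ← lt_linv]; rfl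
        have e2 : (lt y)⁻¹ * r j * lt y = (lt y)⁻¹ * FreeGroup.mk t := by rw [e]; group
        rw [e2]
        have h2 := wl_mul (lt y)⁻¹ (FreeGroup.mk t)
        have h3 := wl_mk_le t
        have h4 : wordLength (r j) = t.length + 1 := by unfold wordLength; rw [ht]; simp
        rw [wl_inv, wl_lt] at h2
        omega
      · exfalso
        have hj0 : (r j).toWord ≠ [] := by simpa using hr1 j
        have hred : FreeGroup.IsReduced ((r i).toWord ++ (r j).toWord) := by
          refine red_append FreeGroup.isReduced_toWord FreeGroup.isReduced_toWord ?_
          intro a ha b hb hba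
          rw [hym, ← List.cons_append, List.getLast?_concat] at ha
          have : a = linv y := by simpa using ha.symm
          rw [this, linv_linv] at hba
          rw [hba] at hb
          exact h1 hb
        have hCR : CR ((r i).toWord ++ (r j).toWord) := by
          refine red_append hred hred ?_
          intro a ha b hb hba
          rw [List.getLast?_append_of_ne_nil _ hj0] at ha
          have : b = y := by rw [hym] at hb; simpa using hb.symm
          rw [this] at hba
          rw [hba, linv_linv] at h2
          exact h2 ha
        have e1 := cl_mk hCR
        rw [← FreeGroup.mul_mk, FreeGroup.mk_toWord, FreeGroup.mk_toWord] at e1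
        have e2 : r i * r j = p⁻¹ * β (FreeGroup.of i * FreeGroup.of j) * p := by
          rw [map_mul]; simp only [hr]; group
        have e3 := hcl (FreeGroup.of i * FreeGroup.of j)
        rw [← e2, e1] at e3
        have e4 := wl_mul (FreeGroup.of i : FG k) (FreeGroup.of j)
        rw [hof i, hof j, wl_lt, wl_lt] at e4
        rw [hof i, hof j] at e3
        have e5 := hrl j
        unfold wordLength at e5
        have e6 : (r i).toWord.length = m.length + 2 := by rw [hym]; simp
        rw [List.length_append] at e3
        omega
  have hlt : ∑ j, wordLength ((lt y)⁻¹ * r j * lt y) < ∑ j, wordLength (r j) :=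
    Finset.sum_lt_sum (fun j _ => hall j) ⟨i, Finset.mem_univ _, hdec⟩
  have := hp (p * lt y)
  have e : ∀ j, (p * lt y)⁻¹ * β (FreeGroup.of j) * (p * lt y) = (lt y)⁻¹ * r j * lt y := by
    intro j; simp only [hr]; group
  simp only [e] at this
  exact absurd hlt (not_lt.2 this)

lemma letterSet_eq : letterSet k = Set.range (lt : Letter k → FG k) := by
  ext g
  constructor
  · intro h
    obtain ⟨y, hy⟩ := of_mem h
    exact ⟨y, hy.symm⟩
  · rintro ⟨y, rfl⟩
    exact lt_mem y

lemma letters_perm (τ : MulAut (FG k)) (h : ∀ i, ∃ y, τ (FreeGroup.of i) = lt y) : IsRelabeling τ := by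
  have hfin : (letterSet k).Finite := by rw [letterSet_eq]; exact Set.finite_range _
  unfold IsRelabeling
  refine Set.eq_of_subset_of_ncard_le ?_ ?_ hfin
  · rintro _ ⟨g, ⟨i, hg⟩, rfl⟩
    obtain ⟨y, hy⟩ := h i
    rcases hg with rfl | rfl
    · rw [hy]; exact lt_mem y
    · rw [map_inv, hy, ← lt_linv]; exact lt_mem _
  · rw [Set.ncard_image_of_injective _ τ.injective]

end endsec

theorem TS_conj_inner_aux {k : ℕ} {w : FG k} (hw : w ∈ TS k) (hw1 : w ≠ 1)
    (α : MulAut (FG k)) (h : IsConj (α w) w) : IsInner α := by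
  obtain ⟨c, hc⟩ := isConj_iff.1 h.symm
  obtain ⟨p, hp⟩ := endgame α⁻¹ (cl_beta hw.1 hw1 hc.symm)
  set τ : MulAut (FG k) := MulAut.conj p⁻¹ * α⁻¹ with hτ
  have hτa : ∀ g, τ g = p⁻¹ * α⁻¹ g * p := by
    intro g; rw [hτ, MulAut.mul_apply, MulAut.conj_apply, inv_inv]
  have hrel : IsRelabeling τ := by
    apply letters_perm
    intro i
    obtain ⟨y, hy⟩ := hp i
    exact ⟨y, by rw [hτa]; exact hy⟩
  have hconj : IsConj (τ w) w := by
    have h1 : α⁻¹ w = (α⁻¹ c)⁻¹ * w * α⁻¹ c := by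
      have := congrArg (α⁻¹ : MulAut (FG k)) hc
      rw [map_mul, map_mul, map_inv, MulAut.inv_apply_self] at this
      calc α⁻¹ w = (α⁻¹ c)⁻¹ * (α⁻¹ c * α⁻¹ w * (α⁻¹ c)⁻¹) * α⁻¹ c := by group
        _ = _ := by rw [this]
    rw [isConj_iff]
    refine ⟨α⁻¹ c * p, ?_⟩
    rw [hτa, h1]; group
  have hone : τ = 1 := by
    by_contra hne
    exact hw.2.2 τ hrel hne hconj
  refine ⟨p⁻¹, ?_⟩
  rw [hτ, mul_inv_eq_one] at hone
  exact hone.symm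


/-- if `w ∈ TS` is nontrivial and `α w` is conjugate to `w`, then `α`
is an inner automorphism of `F_k`. -/
theorem TS_conj_inner (k : ℕ) (hk : 2 ≤ k) (w : FG k)
    (hw : w ∈ TS k) (hne : w ≠ 1) (α : MulAut (FG k)) (h : IsConj (α w) w) :
    IsInner α := by
  exact TS_conj_inner_aux hw hne α h
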